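/- arXiv:2010.10256 — 2 statements merged into one kernel-verified Lean document; each statement's English description precedes it below -/
import Mathlib

section
/- Let α₁, …, αₙ be nonzero algebraic complex numbers and let ℓ₁, …, ℓₙ be complex numbers with exp(ℓᵢ) = αᵢ for each i (arbitrary choices of logarithms). If ℓ₁, …, ℓₙ are linearly independent over the rationals ℚ, then the numbers 1, ℓ₁, …, ℓₙ are linearly independent over the field of all complex algebraic numbers. -/
open Polynomial in
/-- The constant-coefficient differential operator `U(d/dX)` attached to a polynomial `U`. -/
noncomputable def diffOp {R : Type*} [CommRing R] : R[X] →ₐ[R] Module.End R R[X] :=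
  aeval (derivative : Module.End R R[X])

section DiffOp

open Polynomial

variable {R : Type*} [CommRing R]

lemma diffOp_mul_apply (U V P : R[X]) : diffOp (U * V) P = diffOp U (diffOp V P) := by
  rw [map_mul, Module.End.mul_apply]

lemma diffOp_C_apply (a : R) (P : R[X]) : diffOp (C a) P = C a * P := by
  rw [diffOp, aeval_C, Module.algebraMap_end_apply, smul_eq_C_mul]

lemma diffOp_X_apply (P : R[X]) : diffOp X P = derivative P := by
  rw [diffOp, aeval_X]

lemma diffOp_linear_apply (a c : R) (P : R[X]) :
    diffOp (C a + C c * X) P = C a * P + C c * derivative P := by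
  rw [map_add, LinearMap.add_apply, diffOp_mul_apply, diffOp_C_apply, diffOp_C_apply,
    diffOp_X_apply]

lemma map_diffOp {R' : Type*} [CommRing R'] (τ : R →+* R') (U P : R[X]) :
    (diffOp U P).map τ = diffOp (U.map τ) (P.map τ) := by
  induction U using Polynomial.induction_on' generalizing P with
  | add p q hp hq => simp [hp, hq]
  | monomial n a =>
    rw [← C_mul_X_pow_eq_monomial, Polynomial.map_mul, diffOp_mul_apply, diffOp_mul_apply,
      map_C, diffOp_C_apply, diffOp_C_apply, Polynomial.map_mul, map_C]
    congr 1
    induction n generalizing P with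
    | zero => simp
    | succ n ih =>
      rw [pow_succ, diffOp_mul_apply, ih, Polynomial.map_mul, diffOp_mul_apply, diffOp_X_apply,
        map_X, diffOp_X_apply, derivative_map]

/-- The value at `Z` of the polynomial whose coefficients are the absolute values of those
of `P`, truncated at degree `L`. -/
noncomputable def coeffNorm (L : ℕ) (Z : ℝ) (P : ℂ[X]) : ℝ :=
  ∑ i ∈ Finset.range L, ‖P.coeff i‖ * Z ^ i

lemma coeffNorm_nonneg {L : ℕ} {Z : ℝ} (hZ : 0 ≤ Z) (P : ℂ[X]) : 0 ≤ coeffNorm L Z P :=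
  Finset.sum_nonneg fun _ _ => by positivity

lemma norm_eval_le_coeffNorm {L : ℕ} {Z : ℝ} {P : ℂ[X]} (hP : P.natDegree < L) {z : ℂ}
    (hz : ‖z‖ ≤ Z) : ‖P.eval z‖ ≤ coeffNorm L Z P := by
  rw [eval_eq_sum_range' hP]
  refine (norm_sum_le _ _).trans (Finset.sum_le_sum fun i _ => ?_)
  rw [norm_mul, norm_pow]
  gcongr

lemma coeffNorm_linear_le {L : ℕ} {Z : ℝ} (hZ : 1 ≤ Z) {P : ℂ[X]} (hP : P.natDegree < L)
    {a c : ℂ} {A B : ℝ} (ha : ‖a‖ ≤ A) (hc : ‖c‖ ≤ B) :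
    coeffNorm L Z (diffOp (C a + C c * X) P) ≤ (A + B * L) * coeffNorm L Z P := by
  have hB : 0 ≤ B := (norm_nonneg c).trans hc
  have h1 : ∀ i, ‖(diffOp (C a + C c * X) P).coeff i‖ * Z ^ i ≤
      A * (‖P.coeff i‖ * Z ^ i) + B * (‖P.coeff (i + 1)‖ * (i + 1) * Z ^ i) := by
    intro i
    rw [diffOp_linear_apply, coeff_add, coeff_C_mul, coeff_C_mul, coeff_derivative]
    have : ‖a * P.coeff i + c * (P.coeff (i + 1) * (i + 1))‖ ≤
        A * ‖P.coeff i‖ + B * (‖P.coeff (i + 1)‖ * (i + 1)) := by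
      refine (norm_add_le _ _).trans ?_
      have h2 : ‖(i + 1 : ℂ)‖ = i + 1 := by
        rw [← Nat.cast_add_one, Complex.norm_natCast]; push_cast; rfl
      rw [norm_mul, norm_mul, norm_mul, h2]
      gcongr
    have hZi : 0 ≤ Z ^ i := by positivity
    nlinarith [mul_le_mul_of_nonneg_right this hZi]
  have h3 : ∑ i ∈ Finset.range L, ‖P.coeff (i + 1)‖ * (i + 1) * Z ^ i ≤ L * coeffNorm L Z P := by
    calc _ ≤ ∑ i ∈ Finset.range L, L * (‖P.coeff (i + 1)‖ * Z ^ (i + 1)) := by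
          refine Finset.sum_le_sum fun i hi => ?_
          have hi' : (i + 1 : ℝ) ≤ L := by exact_mod_cast Finset.mem_range.mp hi
          have : Z ^ i ≤ Z ^ (i + 1) := pow_le_pow_right₀ hZ (Nat.le_succ i)
          calc _ = (i + 1) * (‖P.coeff (i + 1)‖ * Z ^ i) := by ring
            _ ≤ _ := by gcongr
      _ = L * ∑ i ∈ Finset.range L, (‖P.coeff (i + 1)‖ * Z ^ (i + 1)) := by
          rw [Finset.mul_sum]
      _ ≤ L * coeffNorm L Z P := by
          gcongr
          have h := Finset.sum_range_succ' (fun i => ‖P.coeff i‖ * Z ^ i) L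
          rw [Finset.sum_range_succ, coeff_eq_zero_of_natDegree_lt hP] at h
          simp only [norm_zero, zero_mul, add_zero] at h
          rw [coeffNorm, h]
          have : 0 ≤ ‖P.coeff 0‖ * Z ^ 0 := by positivity
          linarith
  calc _ ≤ ∑ i ∈ Finset.range L, (A * (‖P.coeff i‖ * Z ^ i) +
        B * (‖P.coeff (i + 1)‖ * (i + 1) * Z ^ i)) := Finset.sum_le_sum fun i _ => h1 i
    _ = A * coeffNorm L Z P + B * ∑ i ∈ Finset.range L, ‖P.coeff (i + 1)‖ * (i + 1) * Z ^ i := by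
        rw [Finset.sum_add_distrib, ← Finset.mul_sum, ← Finset.mul_sum, coeffNorm]
    _ ≤ A * coeffNorm L Z P + B * (L * coeffNorm L Z P) := by gcongr
    _ = _ := by ring

lemma natDegree_diffOp_linear_le (a c : R) (P : R[X]) :
    (diffOp (C a + C c * X) P).natDegree ≤ P.natDegree := by
  rw [diffOp_linear_apply]
  refine natDegree_add_le_of_degree_le (natDegree_C_mul_le _ _) ?_
  exact (natDegree_C_mul_le _ _).trans ((natDegree_derivative_le P).trans (Nat.sub_le _ _))

lemma coeffNorm_diffOp_prod_le {ι : Type*} {L : ℕ} {Z : ℝ} (hZ : 1 ≤ Z) {P : ℂ[X]}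
    (hP : P.natDegree < L) {A B : ℝ} (a c : ι → ℂ) (ha : ∀ i, ‖a i‖ ≤ A) (hc : ∀ i, ‖c i‖ ≤ B)
    (hAB : 0 ≤ A + B * L) (m : Multiset ι) :
    (diffOp (m.map fun i => C (a i) + C (c i) * X).prod P).natDegree < L ∧
    coeffNorm L Z (diffOp (m.map fun i => C (a i) + C (c i) * X).prod P) ≤
      (A + B * L) ^ m.card * coeffNorm L Z P := by
  induction m using Multiset.induction_on with
  | empty => simp [hP]
  | cons i m ih =>
    rw [Multiset.map_cons, Multiset.prod_cons, diffOp_mul_apply, Multiset.card_cons, pow_succ']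
    refine ⟨(natDegree_diffOp_linear_le _ _ _).trans_lt ih.1,
      (coeffNorm_linear_le hZ ih.1 (ha i) (hc i)).trans ?_⟩
    rw [mul_assoc]
    exact mul_le_mul_of_nonneg_left ih.2 hAB

end DiffOp

section Schwarz

/-- An entire function with a zero of order at least `m` at `a` is divisible by `(z - a) ^ m`
in the ring of entire functions. -/
lemma Differentiable.exists_eq_pow_mul_of_le_analyticOrderAt {g : ℂ → ℂ}
    (hg : Differentiable ℂ g) {a : ℂ} {m : ℕ} (hm : (m : ℕ∞) ≤ analyticOrderAt g a) :
    ∃ h : ℂ → ℂ, Differentiable ℂ h ∧ ∀ z, g z = (z - a) ^ m * h z := by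
  induction m generalizing g with
  | zero => exact ⟨g, hg, by simp⟩
  | succ m ih =>
    have ha : g a = 0 := by
      refine apply_eq_zero_of_analyticOrderAt_ne_zero fun h0 => ?_
      rw [h0] at hm
      simp at hm
    have hd : Differentiable ℂ (dslope g a) := by
      rw [← differentiableOn_univ, Complex.differentiableOn_dslope Filter.univ_mem,
        differentiableOn_univ]
      exact hg
    have hfac : ∀ z, g z = (z - a) * dslope g a z := by
      intro z
      have := sub_smul_dslope g a z
      rw [smul_eq_mul, ha, sub_zero] at this
      exact this.symm
    have hord : analyticOrderAt g a = 1 + analyticOrderAt (dslope g a) a := by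
      have h1 : g = (fun z => z - a) * dslope g a := funext hfac
      conv_lhs => rw [h1]
      rw [analyticOrderAt_mul (by fun_prop) (hd.analyticAt a)]
      congr 1
      exact analyticOrderAt_id_sub_const_self
    have hm' : (m : ℕ∞) ≤ analyticOrderAt (dslope g a) a := by
      rw [hord, Nat.cast_add, Nat.cast_one, add_comm] at hm
      exact (ENat.add_le_add_iff_left ENat.one_ne_top).mp hm
    obtain ⟨h, hh, hgh⟩ := ih hd hm'
    refine ⟨h, hh, fun z => ?_⟩
    rw [hfac, hgh, pow_succ']
    ring

lemma Differentiable.exists_eq_prod_pow_mul {g : ℂ → ℂ} (hg : Differentiable ℂ g) {N m : ℕ}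
    (hz : ∀ n < N, ∀ i < m, iteratedDeriv i g n = 0) :
    ∃ h : ℂ → ℂ, Differentiable ℂ h ∧
      ∀ z, g z = (∏ n ∈ Finset.range N, (z - n) ^ m) * h z := by
  induction N with
  | zero => exact ⟨g, hg, by simp⟩
  | succ N ih =>
    obtain ⟨h, hh, hgh⟩ := ih fun n hn => hz n (hn.trans (Nat.lt_succ_self N))
    have hQ : Differentiable ℂ fun z : ℂ => ∏ n ∈ Finset.range N, (z - n) ^ m := by fun_prop
    have hord : (m : ℕ∞) ≤ analyticOrderAt h N := by
      have h1 : (m : ℕ∞) ≤ analyticOrderAt g N :=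
        (natCast_le_analyticOrderAt_iff_iteratedDeriv_eq_zero (hg.analyticAt _)).mpr
          (hz N (Nat.lt_succ_self N))
      have h2 : g = (fun z : ℂ => ∏ n ∈ Finset.range N, (z - n) ^ m) * h := funext hgh
      rw [h2, analyticOrderAt_mul (hQ.analyticAt _) (hh.analyticAt _)] at h1
      have h3 : analyticOrderAt (fun z : ℂ => ∏ n ∈ Finset.range N, (z - n) ^ m) N = 0 := by
        rw [(hQ.analyticAt _).analyticOrderAt_eq_zero]
        refine Finset.prod_ne_zero_iff.mpr fun n hn => pow_ne_zero _ (sub_ne_zero.mpr ?_)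
        exact_mod_cast (Finset.mem_range.mp hn).ne'
      rwa [h3, zero_add] at h1
    obtain ⟨k, hk, hhk⟩ := hh.exists_eq_pow_mul_of_le_analyticOrderAt hord
    refine ⟨k, hk, fun z => ?_⟩
    rw [hgh, hhk, Finset.prod_range_succ]
    ring

/-- A Schwarz lemma for an entire function with zeros of order at least `m` at
`0, 1, …, N - 1`. -/
lemma norm_iteratedDeriv_le_of_zeros {g : ℂ → ℂ} (hg : Differentiable ℂ g) {N m : ℕ} {R G : ℝ}
    (hR : 2 * N ≤ R) (hz : ∀ n < N, ∀ i < m, iteratedDeriv i g n = 0)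
    (hG : ∀ z, ‖z‖ ≤ R → ‖g z‖ ≤ G) {n₀ : ℕ} (hn₀ : n₀ < N) :
    ‖iteratedDeriv m g n₀‖ ≤ m.factorial * ((4 * N / R) ^ (N * m) * G) := by
  obtain ⟨h, hh, hgh⟩ := hg.exists_eq_prod_pow_mul hz
  have hN : (1 : ℝ) ≤ N := by exact_mod_cast (Nat.zero_le n₀).trans_lt hn₀
  have hR0 : 0 < R := by linarith
  have hprod : ∀ z : ℂ, ‖∏ n ∈ Finset.range N, (z - n) ^ m‖ =
      ∏ n ∈ Finset.range N, ‖z - n‖ ^ m := by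
    intro z
    rw [norm_prod]
    exact Finset.prod_congr rfl fun n _ => norm_pow _ _
  have hnat : ∀ n ∈ Finset.range N, ‖(n : ℂ)‖ ≤ N := fun n hn => by
    rw [Complex.norm_natCast]
    exact_mod_cast (Finset.mem_range.mp hn).le
  have hbound : ∀ z, ‖z‖ ≤ R → ‖h z‖ ≤ G / (R / 2) ^ (N * m) := by
    intro z hz'
    refine Complex.norm_le_of_forall_mem_frontier_norm_le (U := Metric.ball (0 : ℂ) R)
      Metric.isBounded_ball hh.diffContOnCl (fun w hw => ?_) ?_
    · rw [frontier_ball (0 : ℂ) hR0.ne', mem_sphere_zero_iff_norm] at hw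
      rw [le_div_iff₀ (by positivity)]
      refine le_trans ?_ (hG w hw.le)
      rw [hgh, norm_mul, mul_comm, hprod]
      refine mul_le_mul_of_nonneg_right ?_ (norm_nonneg _)
      calc (R / 2) ^ (N * m) = ∏ n ∈ Finset.range N, (R / 2) ^ m := by
            rw [Finset.prod_const, Finset.card_range, ← pow_mul, mul_comm]
        _ ≤ _ := by
            refine Finset.prod_le_prod (fun _ _ => by positivity) fun n hn => ?_
            gcongr
            have := norm_sub_norm_le w n
            linarith [hnat n hn]
    · rw [closure_ball (0 : ℂ) hR0.ne', mem_closedBall_zero_iff]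
      exact hz'
  have hG0 : 0 ≤ G := (norm_nonneg _).trans (hG 0 (by simpa using hR0.le))
  have key := Complex.norm_iteratedDeriv_le_of_forall_mem_sphere_norm_le (c := (n₀ : ℂ)) m
    (zero_lt_one' ℝ) hg.diffContOnCl (C := (4 * N / R) ^ (N * m) * G) (fun z hz' => ?_)
  · simpa [mul_assoc] using key
  · have hn₀' : ‖(n₀ : ℂ)‖ + 1 ≤ N := by
      rw [Complex.norm_natCast]; exact_mod_cast hn₀
    rw [mem_sphere_iff_norm] at hz'
    have hzN : ‖z‖ ≤ N := by
      have := norm_sub_norm_le z n₀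
      linarith
    rw [hgh, norm_mul, hprod]
    calc _ ≤ (∏ n ∈ Finset.range N, (2 * N : ℝ) ^ m) * (G / (R / 2) ^ (N * m)) := by
          gcongr with n hn
          · exact (norm_sub_le _ _).trans (by linarith [hnat n hn])
          · exact hbound z (by linarith)
      _ = _ := by
          rw [Finset.prod_const, Finset.card_range, ← pow_mul, mul_comm m N, div_pow, div_pow,
            mul_pow, mul_pow]
          have h4 : (4 : ℝ) ^ (N * m) = 2 ^ (N * m) * 2 ^ (N * m) := by
            rw [← mul_pow]; norm_num
          rw [h4]
          field_simp

end Schwarz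

section Expand

/-- Expanding a product of linear combinations. -/
lemma norm_map_prod_le {J S 𝒰 : Type*} [Fintype J] [CommRing 𝒰] [Algebra ℂ 𝒰]
    {u : J → 𝒰} {v : S → 𝒰} {a : S → J → ℂ} (hv : ∀ s, v s = ∑ j, a s j • u j) {A ε : ℝ}
    (hA : ∀ s j, ‖a s j‖ ≤ A) (hA0 : 0 ≤ A) (m : Multiset S) (φ : 𝒰 →ₗ[ℂ] ℂ)
    (h : ∀ m' : Multiset J, m'.card = m.card → ‖φ (m'.map u).prod‖ ≤ ε) :
    ‖φ (m.map v).prod‖ ≤ (Fintype.card J * A) ^ m.card * ε := by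
  induction m using Multiset.induction_on generalizing φ with
  | empty => simpa using h 0 rfl
  | cons s m ih =>
    have h1 : φ ((s ::ₘ m).map v).prod =
        ∑ j, a s j * (φ ∘ₗ LinearMap.mulLeft ℂ (u j)) (m.map v).prod := by
      rw [Multiset.map_cons, Multiset.prod_cons, hv, Finset.sum_mul, map_sum]
      refine Finset.sum_congr rfl fun j _ => ?_
      rw [smul_mul_assoc, map_smul, smul_eq_mul]
      rfl
    rw [h1, Multiset.card_cons, pow_succ']
    calc _ ≤ ∑ j : J, A * ((Fintype.card J * A) ^ m.card * ε) := by
          refine (norm_sum_le _ _).trans (Finset.sum_le_sum fun j _ => ?_)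
          rw [norm_mul]
          refine mul_le_mul (hA s j) (ih _ fun m' hm' => ?_) (norm_nonneg _) hA0
          have := h (j ::ₘ m') (by rw [Multiset.card_cons, Multiset.card_cons, hm'])
          rwa [Multiset.map_cons, Multiset.prod_cons] at this
      _ = _ := by
          rw [Finset.sum_const, Finset.card_univ, nsmul_eq_mul]
          ring

end Expand

section ExpPoly

open Polynomial

/-- The derivation in the direction `v` maps `∑ P_l(z_{s₀}) exp(x_l · z)` to
`∑ (symbol v l)(∂) P_l (z_{s₀}) exp(x_l · z)`. -/
noncomputable def symbol {Λ S : Type*} [Fintype S] (x : Λ → S → ℂ) (s₀ : S) (v : S → ℂ) :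
    Λ → ℂ[X] :=
  fun l => C (∑ s, x l s * v s) + C (v s₀) * X

lemma symbol_sum {Λ S J : Type*} [Fintype S] [Fintype J] (x : Λ → S → ℂ) (s₀ : S)
    (a : J → ℂ) (y : J → S → ℂ) :
    symbol x s₀ (∑ j, a j • y j) = ∑ j, a j • symbol x s₀ (y j) := by
  funext l
  simp only [symbol, Finset.sum_apply, Pi.smul_apply, smul_eq_mul, smul_add, smul_eq_C_mul]
  rw [Finset.sum_add_distrib]
  congr 1
  · simp_rw [← C_mul]
    rw [← map_sum]
    congr 1
    simp_rw [Finset.mul_sum]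
    rw [Finset.sum_comm]
    exact Finset.sum_congr rfl fun j _ => Finset.sum_congr rfl fun s _ => by ring
  · rw [map_sum, Finset.sum_mul]
    exact Finset.sum_congr rfl fun j _ => by rw [C_mul, mul_assoc]

/-- The value at `z` of the image of `∑ P_l(z_{s₀}) exp(x_l · z)` under the differential operator
with symbol `U`. -/
noncomputable def expEval {Λ S : Type*} [Fintype Λ] [Fintype S] (x : Λ → S → ℂ) (s₀ : S)
    (P : Λ → ℂ[X]) (z : S → ℂ) : (Λ → ℂ[X]) →ₗ[ℂ] ℂ where
  toFun U := ∑ l, (diffOp (U l) (P l)).eval (z s₀) * Complex.exp (∑ s, x l s * z s)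
  map_add' U V := by
    rw [← Finset.sum_add_distrib]
    exact Finset.sum_congr rfl fun l _ => by simp [add_mul]
  map_smul' a U := by
    rw [RingHom.id_apply, smul_eq_mul, Finset.mul_sum]
    exact Finset.sum_congr rfl fun l _ => by simp [mul_assoc]

variable {Λ S : Type*} [Fintype Λ] [Fintype S] (x : Λ → S → ℂ) (s₀ : S) (P : Λ → ℂ[X])

lemma expEval_apply (z : S → ℂ) (U : Λ → ℂ[X]) : expEval x s₀ P z U =
    ∑ l, (diffOp (U l) (P l)).eval (z s₀) * Complex.exp (∑ s, x l s * z s) := rfl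

lemma hasDerivAt_expEval (z v : S → ℂ) (U : Λ → ℂ[X]) (t : ℂ) :
    HasDerivAt (fun t : ℂ => expEval x s₀ P (z + t • v) U)
      (expEval x s₀ P (z + t • v) (symbol x s₀ v * U)) t := by
  simp only [expEval_apply]
  refine HasDerivAt.fun_sum fun l _ => ?_
  have h1 : HasDerivAt (fun t : ℂ => ∑ s, x l s * (z + t • v) s) (∑ s, x l s * v s) t := by
    refine HasDerivAt.fun_sum fun s _ => ?_
    have := (((hasDerivAt_id' t).mul_const (v s)).const_add (z s)).const_mul (x l s)
    simpa using this
  have h2 : HasDerivAt (fun t : ℂ => (z + t • v) s₀) (v s₀) t := by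
    simpa using ((hasDerivAt_id' t).mul_const (v s₀)).const_add (z s₀)
  have h3 := ((diffOp (U l) (P l)).hasDerivAt ((z + t • v) s₀)).comp t h2
  refine (h3.mul h1.cexp).congr_deriv ?_
  rw [Pi.mul_apply, diffOp_mul_apply, symbol, diffOp_linear_apply]
  simp only [eval_add, eval_mul, eval_C, Function.comp_apply]
  ring

lemma iteratedDeriv_expEval (z v : S → ℂ) (U : Λ → ℂ[X]) (i : ℕ) :
    iteratedDeriv i (fun t : ℂ => expEval x s₀ P (z + t • v) U) =
      fun t => expEval x s₀ P (z + t • v) (symbol x s₀ v ^ i * U) := by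
  induction i with
  | zero => simp
  | succ i ih =>
    rw [iteratedDeriv_succ, ih]
    funext t
    rw [(hasDerivAt_expEval x s₀ P z v _ t).deriv, pow_succ', mul_assoc]

lemma norm_expEval_le {ι : Type*} {L : ℕ} {Z Q E A B : ℝ} (hP : ∀ l, (P l).natDegree < L)
    (hZ : 1 ≤ Z) (hQ : ∀ l, coeffNorm L Z (P l) ≤ Q) {z : S → ℂ} (hz : ‖z s₀‖ ≤ Z)
    (hE : ∀ l, ‖∑ s, x l s * z s‖ ≤ E) (y : ι → S → ℂ)
    (hA : ∀ l i, ‖∑ s, x l s * y i s‖ ≤ A) (hB : ∀ i, ‖y i s₀‖ ≤ B) (hAB : 0 ≤ A + B * L)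
    (m : Multiset ι) :
    ‖expEval x s₀ P z (m.map fun i => symbol x s₀ (y i)).prod‖ ≤
      Fintype.card Λ * ((A + B * L) ^ m.card * Q * Real.exp E) := by
  rw [expEval_apply]
  have h : ∀ l ∈ Finset.univ, ‖(diffOp ((m.map fun i => symbol x s₀ (y i)).prod l)
      (P l)).eval (z s₀) * Complex.exp (∑ s, x l s * z s)‖ ≤
      (A + B * L) ^ m.card * Q * Real.exp E := by
    intro l _
    have hm : (m.map fun i => symbol x s₀ (y i)).prod l =
        (m.map fun i => C (∑ s, x l s * y i s) + C (y i s₀) * X).prod := by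
      rw [Pi.multiset_prod_apply, Multiset.map_map]
      rfl
    obtain ⟨h1, h2⟩ := coeffNorm_diffOp_prod_le hZ (hP l) (fun i => ∑ s, x l s * y i s)
      (fun i => y i s₀) (hA l) hB hAB m
    rw [hm, norm_mul, Complex.norm_exp]
    have h3 := (Complex.re_le_norm _).trans (hE l)
    have h4 : (A + B * L) ^ m.card * coeffNorm L Z (P l) ≤ (A + B * L) ^ m.card * Q := by
      gcongr
      exact hQ l
    exact mul_le_mul ((norm_eval_le_coeffNorm h1 hz).trans (h2.trans h4))
      (Real.exp_le_exp.mpr h3) (Real.exp_nonneg _)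
      ((coeffNorm_nonneg (by linarith) _).trans (h2.trans h4))
  refine (norm_sum_le_of_le _ h).trans ?_
  rw [Finset.sum_const, Finset.card_univ, nsmul_eq_mul]

/-- If all derivatives of order `< K` vanish at the points of the grid `∑ n_j y_j`, `n_j < N`,
then the derivatives of order `K` are small at these points. -/
lemma norm_expEval_grid_le {J : Type*} [Fintype J] [Nonempty J] [DecidableEq J]
    {y : J → S → ℂ} {N K : ℕ} {R G : ℝ} (hR : 2 * N ≤ R)
    (hvan : ∀ n : J → ℕ, (∀ j, n j < N) → ∀ m : Multiset J, m.card < K →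
      expEval x s₀ P (∑ j, (n j : ℂ) • y j) (m.map fun j => symbol x s₀ (y j)).prod = 0)
    (hG : ∀ n : J → ℕ, (∀ j, n j < N) → ∀ (j : J) (t : ℂ), ‖t‖ ≤ R →
      ∀ m : Multiset J, m.card ≤ K → ‖expEval x s₀ P ((∑ j, (n j : ℂ) • y j) + t • y j)
        (m.map fun j => symbol x s₀ (y j)).prod‖ ≤ G)
    {n : J → ℕ} (hn : ∀ j, n j < N) (m : Multiset J) (hm : m.card = K) :
    ∃ k ≤ K, K ≤ Fintype.card J * k ∧
      ‖expEval x s₀ P (∑ j, (n j : ℂ) • y j) (m.map fun j => symbol x s₀ (y j)).prod‖ ≤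
        k.factorial * ((4 * N / R) ^ (N * k) * G) := by
  obtain ⟨j, hj⟩ : ∃ j, K ≤ Fintype.card J * m.count j := by
    obtain ⟨j, -, hj⟩ := Finset.exists_max_image Finset.univ (fun j => m.count j)
      Finset.univ_nonempty
    refine ⟨j, ?_⟩
    have h1 : ∑ i : J, m.count i = m.card := Multiset.sum_count_eq_card fun a _ => Finset.mem_univ a
    rw [← hm, ← h1, ← smul_eq_mul, ← Finset.card_univ]
    exact Finset.sum_le_card_nsmul _ _ _ hj
  set u := fun j => symbol x s₀ (y j)
  set k := m.count j
  set m₁ := m.filter fun i => ¬ i = j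
  have hsplit : m = Multiset.replicate k j + m₁ := by
    rw [← Multiset.filter_eq' m j]
    exact (Multiset.filter_add_not _ m).symm
  have hcard : k + m₁.card = K := by
    rw [← hm]
    conv_rhs => rw [hsplit]
    rw [Multiset.card_add, Multiset.card_replicate]
  have hprod : ∀ i, u j ^ i * (m₁.map u).prod = ((Multiset.replicate i j + m₁).map u).prod := by
    intro i
    rw [Multiset.map_add, Multiset.prod_add, Multiset.map_replicate, Multiset.prod_replicate]
  set n' := Function.update n j 0
  have hn' : ∀ i : ℕ, i < N → ∀ a, Function.update n j i a < N := by
    intro i hi a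
    by_cases ha : a = j
    · subst ha; simpa using hi
    · simpa [ha] using hn a
  have hline : ∀ i : ℕ, (∑ a, (n' a : ℂ) • y a) + (i : ℂ) • y j =
      ∑ a, (Function.update n j i a : ℂ) • y a := by
    intro i
    rw [← Finset.add_sum_erase _ _ (Finset.mem_univ j),
      ← Finset.add_sum_erase _ _ (Finset.mem_univ j)]
    have : ∀ a ∈ Finset.univ.erase j, (n' a : ℂ) • y a = (Function.update n j i a : ℂ) • y a := by
      intro a ha
      simp [n', Finset.ne_of_mem_erase ha]
    rw [Finset.sum_congr rfl this]
    simp [n', add_comm]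
  refine ⟨k, by omega, hj, ?_⟩
  have hdiff : Differentiable ℂ fun t : ℂ =>
      expEval x s₀ P ((∑ a, (n' a : ℂ) • y a) + t • y j) (m₁.map u).prod :=
    fun t => (hasDerivAt_expEval x s₀ P _ _ _ t).differentiableAt
  have hN : 0 < N := (Nat.zero_le _).trans_lt (hn j)
  have key := norm_iteratedDeriv_le_of_zeros hdiff hR (m := k) (G := G) ?_ ?_ (hn j)
  · rw [iteratedDeriv_expEval, hprod, ← hsplit] at key
    simp only [hline, Function.update_eq_self] at key
    exact key
  · intro i hi e he
    rw [iteratedDeriv_expEval, hprod]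
    simp only [hline]
    refine hvan _ (hn' i hi) _ ?_
    rw [Multiset.card_add, Multiset.card_replicate]
    omega
  · intro t ht
    exact hG n' (hn' 0 hN) j t ht m₁ (by omega)

end ExpPoly

section Arithmetic

open NumberField

/-- **Siegel's lemma** over a number field, for systems with at least twice as many unknowns as
equations. -/
lemma exists_siegel_solution (F : Type*) [Field F] [NumberField F] :
    ∃ c : ℝ, 1 ≤ c ∧ ∀ (α β : Type) [Fintype α] [Fintype β] (M : Matrix α β (𝓞 F)) (A : ℝ),
      0 < Fintype.card α → 2 * Fintype.card α ≤ Fintype.card β → 1 ≤ A →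
      (∀ k l, house (algebraMap (𝓞 F) F (M k l)) ≤ A) →
      ∃ ξ : β → 𝓞 F, ξ ≠ 0 ∧ M.mulVec ξ = 0 ∧
        ∀ l, house (algebraMap (𝓞 F) F (ξ l)) ≤ c * (Fintype.card β * A) := by
  classical
  obtain ⟨c₁, hc₁⟩ : ∃ c₁ : ℝ, ∀ (α β : Type) [Fintype α] [Fintype β] (M : Matrix α β (𝓞 F))
      (A : ℝ), M ≠ 0 → 0 < Fintype.card α → Fintype.card α < Fintype.card β →
      (∀ k l, house (algebraMap (𝓞 F) F (M k l)) ≤ A) →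
      ∃ ξ : β → 𝓞 F, ξ ≠ 0 ∧ M.mulVec ξ = 0 ∧
        ∀ l, house (algebraMap (𝓞 F) F (ξ l)) ≤ c₁ * (c₁ * Fintype.card β * A) ^
          ((Fintype.card α : ℝ) / (Fintype.card β - Fintype.card α)) :=
    ⟨_, fun α β _ _ M A hM h0 h1 h =>
      NumberField.house.exists_ne_zero_int_vec_house_le F M hM h0 h1 rfl h rfl⟩
  refine ⟨max 1 |c₁| * max 1 |c₁|,
    one_le_mul_of_one_le_of_one_le (le_max_left ..) (le_max_left ..),
    fun α β _ _ M A h0 h2 hA h => ?_⟩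
  set c := max 1 |c₁|
  have hc : 1 ≤ c := le_max_left ..
  have hle : |c₁| ≤ c := le_max_right ..
  have hβ : (1 : ℝ) ≤ Fintype.card β := by exact_mod_cast (by omega : 1 ≤ Fintype.card β)
  have hβA : 1 ≤ Fintype.card β * A := one_le_mul_of_one_le_of_one_le hβ hA
  by_cases hM : M = 0
  · have : Nonempty β := Fintype.card_pos_iff.mp (by omega)
    refine ⟨1, one_ne_zero, by rw [hM, Matrix.zero_mulVec], fun l => ?_⟩
    have h1 : house (algebraMap (𝓞 F) F ((1 : β → 𝓞 F) l)) = 1 := by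
      simpa using house_intCast (K := F) 1
    rw [h1]
    nlinarith [one_le_mul_of_one_le_of_one_le hc hc]
  · obtain ⟨ξ, hξ, hMξ, hb⟩ := hc₁ α β M A hM h0 (by omega) h
    refine ⟨ξ, hξ, hMξ, fun l => (hb l).trans ?_⟩
    have hcard : (2 : ℝ) * Fintype.card α ≤ Fintype.card β := by exact_mod_cast h2
    have hα : (0 : ℝ) < Fintype.card α := by exact_mod_cast h0
    set e : ℝ := (Fintype.card α : ℝ) / (Fintype.card β - Fintype.card α)
    have he1 : e ≤ 1 := (div_le_one (by linarith)).mpr (by linarith)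
    have he0 : 0 ≤ e := div_nonneg hα.le (by linarith)
    have hbase : 1 ≤ c * (Fintype.card β * A) := one_le_mul_of_one_le_of_one_le hc hβA
    have hpow : (c * (Fintype.card β * A)) ^ e ≤ c * (Fintype.card β * A) := by
      simpa using Real.rpow_le_rpow_of_exponent_le hbase he1
    have habs : |c₁ * Fintype.card β * A| = |c₁| * (Fintype.card β * A) := by
      rw [mul_assoc, abs_mul, abs_of_nonneg (a := Fintype.card β * A) (by linarith)]
    calc c₁ * (c₁ * Fintype.card β * A) ^ e
        ≤ |c₁| * |(c₁ * Fintype.card β * A) ^ e| := by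
          rw [← abs_mul]
          exact le_abs_self _
      _ ≤ |c₁| * |c₁ * Fintype.card β * A| ^ e := by
          gcongr
          exact Real.abs_rpow_le_abs_rpow _ _
      _ ≤ c * (c * (Fintype.card β * A)) ^ e := by
          rw [habs]
          gcongr
      _ ≤ c * (c * (Fintype.card β * A)) := by gcongr
      _ = c * c * (Fintype.card β * A) := by ring

lemma one_le_norm_mul_pow_house {F : Type*} [Field F] [NumberField F] {x : 𝓞 F} (hx : x ≠ 0)
    (σ : F →+* ℂ) {H : ℝ} (hH : house (algebraMap (𝓞 F) F x) ≤ H) :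
    1 ≤ ‖σ x‖ * H ^ (Module.finrank ℚ F - 1) := by
  have h1 := norm_norm_le_norm_mul_house_pow (x : F) σ
  have h2 : (1 : ℝ) ≤ ‖Algebra.norm ℚ (x : F)‖ := by
    rw [← Algebra.coe_norm_int]
    have : Algebra.norm ℤ x ≠ 0 := Algebra.norm_ne_zero_iff.mpr hx
    have h3 : (1 : ℤ) ≤ |Algebra.norm ℤ x| := Int.one_le_abs this
    have h4 : ‖((Algebra.norm ℤ x : ℤ) : ℚ)‖ = ((|Algebra.norm ℤ x| : ℤ) : ℝ) := by
      rw [← Rat.norm_cast_real]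
      simp
    rw [h4]
    exact_mod_cast h3
  refine h2.trans (h1.trans ?_)
  gcongr
  exact house_nonneg _

end Arithmetic

section NonVanishing

open Polynomial

lemma diffOp_apply_C {R : Type*} [CommRing R] (U : R[X]) (a : R) :
    diffOp U (C a) = C (U.coeff 0 * a) := by
  induction U using Polynomial.induction_on' with
  | add p q hp hq => simp [hp, hq, add_mul]
  | monomial n b =>
    rw [← C_mul_X_pow_eq_monomial, diffOp_mul_apply, diffOp_C_apply]
    cases n with
    | zero => simp
    | succ n => rw [pow_succ, diffOp_mul_apply, diffOp_X_apply]; simp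

lemma diffOp_X_pow_apply {R : Type*} [CommRing R] (i : ℕ) (P : R[X]) :
    diffOp (X ^ i) P = derivative^[i] P := by
  induction i generalizing P with
  | zero => simp
  | succ i ih => rw [pow_succ, diffOp_mul_apply, diffOp_X_apply, ih, Function.iterate_succ_apply]

/-- A nonzero exponential polynomial in one variable has a nonzero derivative at the origin. -/
lemma exists_sum_diffOp_eval_zero_ne_zero {Λ : Type*} [Fintype Λ] {c : Λ → ℂ}
    (hc : Function.Injective c) {P : Λ → ℂ[X]} (hP : P ≠ 0) :
    ∃ i : ℕ, ∑ l, (diffOp ((C (c l) + X) ^ i) (P l)).eval 0 ≠ 0 := by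
  classical
  by_contra! hall
  have hQ : ∀ Q : ℂ[X], ∑ l, (diffOp (Q.comp (C (c l) + X)) (P l)).eval 0 = 0 := by
    intro Q
    induction Q using Polynomial.induction_on' with
    | add p q hp hq =>
      simp only [add_comp, map_add, LinearMap.add_apply, eval_add, Finset.sum_add_distrib, hp, hq,
        add_zero]
    | monomial n b =>
      simp only [monomial_comp, diffOp_mul_apply, diffOp_C_apply, eval_mul, eval_C]
      rw [← Finset.mul_sum, hall, mul_zero]
  obtain ⟨l₀, hl₀⟩ := Function.ne_iff.mp hP
  set M := (∑ l, (P l).natDegree) + 1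
  set d := (P l₀).natDegree
  have h := hQ ((∏ l ∈ Finset.univ.erase l₀, (X - C (c l)) ^ M) * (X - C (c l₀)) ^ d)
  rw [Finset.sum_eq_single l₀] at h
  · rw [mul_comp, pow_comp, sub_comp, X_comp, C_comp, add_sub_cancel_left, diffOp_mul_apply,
      diffOp_X_pow_apply] at h
    have h1 : derivative^[d] (P l₀) = C ((d.factorial : ℂ) * (P l₀).leadingCoeff) := by
      have h2 : (derivative^[d] (P l₀)).natDegree = 0 := by
        have := natDegree_iterate_derivative (P l₀) d
        simp only [d] at this ⊢
        omega
      rw [eq_C_of_natDegree_eq_zero h2, coeff_iterate_derivative, zero_add, Nat.descFactorial_self,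
        nsmul_eq_mul]
      rfl
    rw [h1, diffOp_apply_C, eval_C] at h
    refine mul_ne_zero ?_ (mul_ne_zero (by exact_mod_cast d.factorial_ne_zero)
      (leadingCoeff_ne_zero.mpr hl₀)) h
    rw [coeff_zero_eq_eval_zero, eval_comp, eval_prod]
    refine Finset.prod_ne_zero_iff.mpr fun l hl => ?_
    simp only [eval_pow, eval_sub, eval_X, eval_C, eval_add, add_zero]
    exact pow_ne_zero _ (sub_ne_zero.mpr fun he => Finset.ne_of_mem_erase hl (hc he).symm)
  · intro l _ hl
    rw [mul_comp, prod_comp, ← Finset.mul_prod_erase _ _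
      (Finset.mem_erase.mpr ⟨hl, Finset.mem_univ l⟩), pow_comp, sub_comp, X_comp, C_comp,
      add_sub_cancel_left, mul_assoc, mul_comm, diffOp_mul_apply, diffOp_X_pow_apply,
      iterate_derivative_eq_zero, map_zero, eval_zero]
    exact Nat.lt_succ_of_le (Finset.single_le_sum (f := fun l => (P l).natDegree)
      (fun _ _ => Nat.zero_le _) (Finset.mem_univ l))
  · exact fun h => (h (Finset.mem_univ _)).elim

end NonVanishing

section AlgebraicValues

open Polynomial

variable {R J S : Type*} [CommRing R] [Fintype J] {L : ℕ}

/-- The frequency `∑ l_j x_j` attached to the exponent vector `l`. -/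
def freq (x : S → J → R) (l : J → Fin L) (s : S) : R :=
  ∑ j, ((l j : ℕ) : R) * x s j

/-- The symbol of the derivation `∂ / ∂ z_s`, with coefficients in `R`. -/
noncomputable def algSymbol [DecidableEq S] (x : S → J → R) (s₀ s : S) :
    (J → Fin L) → R[X] :=
  fun l => C (freq x l s) + C (if s = s₀ then 1 else 0) * X

/-- The value of the exponential monomial with exponent vector `l` at the grid point `n`,
multiplied by a power of `b`. -/
def weight (a : J → J → R) (b N : ℕ) (l : J → Fin L) (n : J → ℕ) : R :=
  ∏ i, ∏ j, (a i j ^ ((l i : ℕ) * n j) * (b : R) ^ (L * N - (l i : ℕ) * n j))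

/-- The value at the grid point `n` of the derivative, with symbol `U`, of the exponential
polynomial with coefficients `P`, multiplied by a power of `b`. -/
noncomputable def algVal [DecidableEq J] (θ : J → R) (a : J → J → R) (b N : ℕ)
    (P : (J → Fin L) → R[X])
    (n : J → ℕ) (U : (J → Fin L) → R[X]) : R :=
  ∑ l, (diffOp (U l) (P l)).eval (∑ j, (n j : R) * θ j) * weight a b N l n

section Bounds

variable {c : ℝ} {τ : R →+* ℂ}

lemma norm_sum_nat_mul_le (hJ : Fintype.card J ≤ c) {N : ℕ} {n : J → ℕ} (hn : ∀ j, n j ≤ N)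
    {θ : J → R} (hθ : ∀ j, ‖τ (θ j)‖ ≤ c) : ‖τ (∑ j, (n j : R) * θ j)‖ ≤ c ^ 2 * N := by
  have hc : 0 ≤ c := (Nat.cast_nonneg _).trans hJ
  rw [map_sum]
  have h : ∀ j ∈ Finset.univ, ‖τ ((n j : R) * θ j)‖ ≤ N * c := by
    intro j _
    rw [map_mul, map_natCast, norm_mul, Complex.norm_natCast]
    have : (n j : ℝ) ≤ N := by exact_mod_cast hn j
    exact mul_le_mul this (hθ j) (norm_nonneg _) (Nat.cast_nonneg _)
  refine (norm_sum_le_of_le _ h).trans ?_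
  rw [Finset.sum_const, Finset.card_univ, nsmul_eq_mul]
  calc (Fintype.card J : ℝ) * (N * c) ≤ c * (N * c) := by gcongr
    _ = c ^ 2 * N := by ring

lemma norm_freq_le (hJ : Fintype.card J ≤ c) {x : S → J → R} (hx : ∀ s j, ‖τ (x s j)‖ ≤ c)
    (l : J → Fin L) (s : S) : ‖τ (freq x l s)‖ ≤ c ^ 2 * L :=
  norm_sum_nat_mul_le hJ (n := fun j => l j) (fun j => (l j).2.le) (hx s)

lemma norm_weight_le (hc : 1 ≤ c) {a : J → J → R} (ha : ∀ i j, ‖τ (a i j)‖ ≤ c) {b N : ℕ}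
    (hb : b ≤ c) (l : J → Fin L) {n : J → ℕ} (hn : ∀ j, n j ≤ N) :
    ‖τ (weight a b N l n)‖ ≤ c ^ (Fintype.card J ^ 2 * (L * N)) := by
  rw [weight, map_prod, norm_prod]
  have h : ∀ i j, ‖τ (a i j ^ ((l i : ℕ) * n j) * (b : R) ^ (L * N - (l i : ℕ) * n j))‖ ≤
      c ^ (L * N) := by
    intro i j
    have hle : (l i : ℕ) * n j ≤ L * N := Nat.mul_le_mul (l i).2.le (hn j)
    rw [map_mul, map_pow, map_pow, map_natCast, norm_mul, norm_pow, norm_pow,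
      Complex.norm_natCast]
    calc ‖τ (a i j)‖ ^ ((l i : ℕ) * n j) * (b : ℝ) ^ (L * N - (l i : ℕ) * n j)
        ≤ c ^ ((l i : ℕ) * n j) * c ^ (L * N - (l i : ℕ) * n j) := by
          gcongr
          exact ha i j
      _ = c ^ (L * N) := by rw [← pow_add, Nat.add_sub_cancel' hle]
  have h1 : ∀ i ∈ Finset.univ,
      ‖τ (∏ j, (a i j ^ ((l i : ℕ) * n j) * (b : R) ^ (L * N - (l i : ℕ) * n j)))‖ ≤
      c ^ (Fintype.card J * (L * N)) := by
    intro i _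
    rw [map_prod, norm_prod]
    refine (Finset.prod_le_prod (fun j _ => norm_nonneg _) fun j _ => h i j).trans ?_
    rw [Finset.prod_const, Finset.card_univ, ← pow_mul, mul_comm]
  refine (Finset.prod_le_prod (fun j _ => norm_nonneg _) h1).trans ?_
  rw [Finset.prod_const, Finset.card_univ, ← pow_mul]
  exact le_of_eq (by ring_nf)

lemma map_algSymbol_prod [DecidableEq S] (x : S → J → R) (s₀ : S) (m : Multiset S)
    (l : J → Fin L) :
    ((m.map fun s => algSymbol (L := L) x s₀ s).prod l).map τ =
      (m.map fun s => C (τ (freq x l s)) + C (if s = s₀ then 1 else 0) * X).prod := by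
  rw [Pi.multiset_prod_apply, Polynomial.map_multiset_prod, Multiset.map_map, Multiset.map_map]
  congr 1
  refine Multiset.map_congr rfl fun s _ => ?_
  simp only [algSymbol, Function.comp_apply, Polynomial.map_add, Polynomial.map_mul, map_C, map_X]
  split_ifs <;> simp

variable [DecidableEq S]

lemma norm_diffOp_eval_mul_weight_le (hc : 1 ≤ c) (hJ : Fintype.card J ≤ c) {x : S → J → R}
    (hx : ∀ s j, ‖τ (x s j)‖ ≤ c) {θ : J → R} (hθ : ∀ j, ‖τ (θ j)‖ ≤ c) {a : J → J → R}
    (ha : ∀ i j, ‖τ (a i j)‖ ≤ c) {b N : ℕ} (hb : b ≤ c) (hN : 1 ≤ N) {n : J → ℕ}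
    (hn : ∀ j, n j ≤ N) {L₀ : ℕ} (hL₀ : L₀ ≤ L) (s₀ : S) (l : J → Fin L) {Q : R[X]}
    (hQ : Q.natDegree < L₀) (m : Multiset S) :
    ‖τ ((diffOp ((m.map fun s => algSymbol (L := L) x s₀ s).prod l) Q).eval
        (∑ j, (n j : R) * θ j) * weight a b N l n)‖ ≤
      (2 * c ^ 2 * L) ^ m.card * coeffNorm L₀ (c ^ 2 * N) (Q.map τ) *
        c ^ (Fintype.card J ^ 2 * (L * N)) := by
  have hNr : (1 : ℝ) ≤ N := by exact_mod_cast hN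
  have hLr : (L₀ : ℝ) ≤ L := by exact_mod_cast hL₀
  have hc2 : 1 ≤ c ^ 2 := one_le_pow₀ hc
  have hZ : 1 ≤ c ^ 2 * N := one_le_mul_of_one_le_of_one_le hc2 hNr
  rw [map_mul, norm_mul, ← eval_map_apply, map_diffOp, map_algSymbol_prod]
  obtain ⟨h1, h2⟩ := coeffNorm_diffOp_prod_le (A := c ^ 2 * L) (B := 1) hZ
    ((natDegree_map_le (f := τ)).trans_lt hQ) (fun s => τ (freq x l s))
    (fun s => if s = s₀ then 1 else 0) (norm_freq_le hJ hx l)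
    (fun s => by split_ifs <;> simp) (by positivity) m
  have h3 : c ^ 2 * L + 1 * L₀ ≤ 2 * c ^ 2 * L := by nlinarith
  refine mul_le_mul ((norm_eval_le_coeffNorm h1 (norm_sum_nat_mul_le hJ hn hθ)).trans
    (h2.trans ?_)) (norm_weight_le hc ha hb l hn) (norm_nonneg _)
    (mul_nonneg (by positivity) (coeffNorm_nonneg (by positivity) _))
  refine mul_le_mul_of_nonneg_right ?_ (coeffNorm_nonneg (by positivity) _)
  gcongr

lemma coeffNorm_le {Z p : ℝ} (hZ : 1 ≤ Z) {L₀ : ℕ} (hL₀ : L₀ ≤ L) {Q : ℂ[X]}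
    (hQ : ∀ i, ‖Q.coeff i‖ ≤ p) : coeffNorm L₀ Z Q ≤ L * p * Z ^ L := by
  have hp : 0 ≤ p := (norm_nonneg _).trans (hQ 0)
  have h : ∀ i ∈ Finset.range L₀, ‖Q.coeff i‖ * Z ^ i ≤ p * Z ^ L := by
    intro i hi
    have : i ≤ L := (Finset.mem_range.mp hi).le.trans hL₀
    gcongr
    exact hQ i
  refine (Finset.sum_le_sum h).trans ?_
  rw [Finset.sum_const, Finset.card_range, nsmul_eq_mul, ← mul_assoc]
  gcongr

lemma norm_algVal_le [DecidableEq J] (hc : 1 ≤ c) (hJ : Fintype.card J ≤ c) {x : S → J → R}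
    (hx : ∀ s j, ‖τ (x s j)‖ ≤ c) {θ : J → R} (hθ : ∀ j, ‖τ (θ j)‖ ≤ c) {a : J → J → R}
    (ha : ∀ i j, ‖τ (a i j)‖ ≤ c) {b N : ℕ} (hb : b ≤ c) (hN : 1 ≤ N) {n : J → ℕ}
    (hn : ∀ j, n j ≤ N) {L₀ : ℕ} (hL₀ : L₀ ≤ L) (s₀ : S) {P : (J → Fin L) → R[X]}
    (hP : ∀ l, (P l).natDegree < L₀) {p : ℝ} (hp : ∀ l i, ‖τ ((P l).coeff i)‖ ≤ p)
    (m : Multiset S) :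
    ‖τ (algVal θ a b N P n (m.map fun s => algSymbol (L := L) x s₀ s).prod)‖ ≤
      (L : ℝ) ^ Fintype.card J * ((2 * c ^ 2 * L) ^ m.card * (L * p * (c ^ 2 * N) ^ L) *
        c ^ (Fintype.card J ^ 2 * (L * N))) := by
  have hNr : (1 : ℝ) ≤ N := by exact_mod_cast hN
  have hZ : 1 ≤ c ^ 2 * N := one_le_mul_of_one_le_of_one_le (one_le_pow₀ hc) hNr
  rw [algVal, map_sum]
  refine (norm_sum_le_of_le (f := fun l => τ (_ * _)) _ fun l _ =>
    (norm_diffOp_eval_mul_weight_le hc hJ hx hθ ha hb hN hn hL₀ s₀ l (hP l) m).trans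
    (mul_le_mul_of_nonneg_right (mul_le_mul_of_nonneg_left
      (coeffNorm_le hZ hL₀ (fun i => by rw [coeff_map]; exact hp l i)) ?_) ?_)).trans_eq ?_
  · positivity
  · positivity
  · simp

end Bounds

lemma map_algVal [DecidableEq J] [DecidableEq S] [Fintype S] {φ : R →+* ℂ} {x : S → J → R}
    {s₀ : S} {w : S → ℂ} {θ : J → R} {a : J → J → R} {b N : ℕ} (hb : b ≠ 0)
    (hexp : ∀ i j, b * Complex.exp (∑ s, φ (x s i) * (φ (x s j) * w s)) = φ (a i j))
    {L₀ : ℕ} (hL₀ : L₀ = 1 ∨ ∀ j, φ (θ j) = φ (x s₀ j) * w s₀)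
    {P : (J → Fin L) → R[X]} (hP : ∀ l, (P l).natDegree < L₀) {n : J → ℕ} (hn : ∀ j, n j ≤ N)
    (m : Multiset S) :
    φ (algVal θ a b N P n (m.map fun s => algSymbol (L := L) x s₀ s).prod) =
      (b : ℂ) ^ (Fintype.card J ^ 2 * (L * N)) *
        expEval (fun l s => φ (freq x l s)) s₀ (fun l => (P l).map φ)
          (∑ j, (n j : ℂ) • fun s => φ (x s j) * w s)
          (m.map fun s => symbol (fun l s => φ (freq x l s)) s₀ (Pi.single s 1)).prod := by
  have hb' : (b : ℂ) ≠ 0 := by exact_mod_cast hb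
  have hsym : ∀ l : J → Fin L,
      (m.map fun s => symbol (fun l s => φ (freq x l s)) s₀ (Pi.single s 1)).prod l =
      ((m.map fun s => algSymbol (L := L) x s₀ s).prod l).map φ := by
    intro l
    rw [map_algSymbol_prod, Pi.multiset_prod_apply, Multiset.map_map]
    congr 1
    refine Multiset.map_congr rfl fun s _ => ?_
    simp [symbol, Pi.single_apply, eq_comm]
  have hw : ∀ l : J → Fin L, φ (weight a b N l n) = (b : ℂ) ^ (Fintype.card J ^ 2 * (L * N)) *
      Complex.exp (∑ s, φ (freq x l s) * (∑ j, (n j : ℂ) • fun s => φ (x s j) * w s) s) := by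
    intro l
    have h1 : ∑ s, φ (freq x l s) * (∑ j, (n j : ℂ) • fun s => φ (x s j) * w s) s =
        ∑ i, ∑ j, (((l i : ℕ) * n j : ℕ) : ℂ) * ∑ s, φ (x s i) * (φ (x s j) * w s) := by
      simp only [freq, map_sum, map_mul, map_natCast, Finset.sum_apply, Pi.smul_apply, smul_eq_mul,
        Finset.sum_mul, Finset.mul_sum]
      rw [Finset.sum_comm]
      rw [Finset.sum_comm_cycle]
      refine Finset.sum_congr rfl fun i _ => Finset.sum_congr rfl fun j _ =>
        Finset.sum_congr rfl fun s _ => ?_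
      push_cast
      ring
    rw [h1, Complex.exp_sum, weight, map_prod]
    have h2 : (b : ℂ) ^ (Fintype.card J ^ 2 * (L * N)) = ∏ _i : J, ∏ _j : J, (b : ℂ) ^ (L * N) := by
      rw [Finset.prod_const, Finset.prod_const, Finset.card_univ, ← pow_mul, ← pow_mul]
      congr 1
      ring
    rw [h2, ← Finset.prod_mul_distrib]
    refine Finset.prod_congr rfl fun i _ => ?_
    rw [Complex.exp_sum, map_prod, ← Finset.prod_mul_distrib]
    refine Finset.prod_congr rfl fun j _ => ?_
    have hle : (l i : ℕ) * n j ≤ L * N := Nat.mul_le_mul (l i).2.le (hn j)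
    rw [Complex.exp_nat_mul, map_mul, map_pow, map_pow, map_natCast, ← hexp, mul_pow,
      ← Nat.sub_add_cancel hle, pow_add, Nat.add_sub_cancel]
    ring
  rw [algVal, map_sum, expEval_apply, Finset.mul_sum]
  refine Finset.sum_congr rfl fun l _ => ?_
  rw [map_mul, hw, hsym, ← map_diffOp]
  have hev : φ ((diffOp ((m.map fun s => algSymbol (L := L) x s₀ s).prod l) (P l)).eval
      (∑ j, (n j : R) * θ j)) =
      ((diffOp ((m.map fun s => algSymbol (L := L) x s₀ s).prod l) (P l)).map φ).eval
      ((∑ j, (n j : ℂ) • fun s => φ (x s j) * w s) s₀) := by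
    rcases hL₀ with h | h
    · have h1 : P l = C ((P l).coeff 0) :=
        eq_C_of_natDegree_eq_zero (by have := hP l; omega)
      rw [h1, diffOp_apply_C]
      simp
    · rw [← eval_map_apply]
      congr 1
      simp [map_sum, h]
  rw [hev]
  ring

end AlgebraicValues

section Construction

open Polynomial NumberField

lemma house_le_iff {F : Type*} [Field F] [NumberField F] {a : F} {H : ℝ} :
    house a ≤ H ↔ ∀ τ : F →+* ℂ, ‖τ a‖ ≤ H := by
  rw [house, canonicalEmbedding.norm_le_iff]

/-- Construction of the auxiliary exponential polynomial. -/
lemma exists_auxiliary {F : Type*} [Field F] [NumberField F] {J S : Type} [Fintype J] [Fintype S]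
    [DecidableEq J] [DecidableEq S] {x : S → J → 𝓞 F} (s₀ : S) {θ : J → 𝓞 F} {a : J → J → 𝓞 F}
    {b : ℕ} {c : ℝ} (hc : 1 ≤ c) (hJ : Fintype.card J ≤ c)
    (hx : ∀ s j, house (algebraMap (𝓞 F) F (x s j)) ≤ c)
    (hθ : ∀ j, house (algebraMap (𝓞 F) F (θ j)) ≤ c)
    (ha : ∀ i j, house (algebraMap (𝓞 F) F (a i j)) ≤ c) (hb : b ≤ c) :
    ∃ cS : ℝ, 1 ≤ cS ∧ ∀ L N T L₀ : ℕ, 1 ≤ N → 1 ≤ T → 1 ≤ L₀ → L₀ ≤ L →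
      2 * (T ^ Fintype.card S * N ^ Fintype.card J) ≤ L ^ Fintype.card J * L₀ →
      ∃ P : (J → Fin L) → (𝓞 F)[X], P ≠ 0 ∧ (∀ l, (P l).natDegree < L₀) ∧
        (∀ l i, house (algebraMap (𝓞 F) F ((P l).coeff i)) ≤
          cS * ((L : ℝ) ^ Fintype.card J * L₀ * ((2 * c ^ 2 * L) ^ (Fintype.card S * T) *
            (c ^ 2 * N) ^ L * c ^ (Fintype.card J ^ 2 * (L * N))))) ∧
        ∀ n : J → ℕ, (∀ j, n j < N) → ∀ m : Multiset S, m.card < T →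
          algVal θ a b N P n (m.map fun s => algSymbol (L := L) x s₀ s).prod = 0 := by
  obtain ⟨cS, hcS, hS⟩ := exists_siegel_solution F
  refine ⟨cS, hcS, fun L N T L₀ hN hT hL₀ hL hcard => ?_⟩
  have hNr : (1 : ℝ) ≤ N := by exact_mod_cast hN
  have hLr : (1 : ℝ) ≤ L := by exact_mod_cast hL₀.trans hL
  have hc2 : 1 ≤ c ^ 2 := one_le_pow₀ hc
  have hZ : 1 ≤ c ^ 2 * N := one_le_mul_of_one_le_of_one_le hc2 hNr
  have hcL : 1 ≤ 2 * c ^ 2 * L := by nlinarith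
  set mk : (S → Fin T) → Multiset S := fun k => ∑ s, Multiset.replicate (k s) s
  have hmk : ∀ k, (mk k).card ≤ Fintype.card S * T := by
    intro k
    simp only [mk, Multiset.card_sum, Multiset.card_replicate]
    refine (Finset.sum_le_sum fun s _ => (k s).2.le).trans ?_
    simp
  set A : ℝ := (2 * c ^ 2 * L) ^ (Fintype.card S * T) * (c ^ 2 * N) ^ L *
    c ^ (Fintype.card J ^ 2 * (L * N))
  have hA : 1 ≤ A := one_le_mul_of_one_le_of_one_le
    (one_le_mul_of_one_le_of_one_le (one_le_pow₀ hcL) (one_le_pow₀ hZ)) (one_le_pow₀ hc)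
  set M : Matrix ((S → Fin T) × (J → Fin N)) ((J → Fin L) × Fin L₀) (𝓞 F) :=
    Matrix.of fun k l =>
      (diffOp (((mk k.1).map fun s => algSymbol (L := L) x s₀ s).prod l.1)
        (X ^ (l.2 : ℕ))).eval (∑ j, ((k.2 j : ℕ) : 𝓞 F) * θ j) *
          weight a b N l.1 (fun j => k.2 j)
  have hM : ∀ k l, house (algebraMap (𝓞 F) F (M k l)) ≤ A := by
    intro k l
    rw [house_le_iff]
    intro τ
    refine (norm_diffOp_eval_mul_weight_le (τ := τ.comp (algebraMap (𝓞 F) F)) hc hJ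
      (fun s j => house_le_iff.mp (hx s j) τ) (fun j => house_le_iff.mp (hθ j) τ)
      (fun i j => house_le_iff.mp (ha i j) τ) hb hN (n := fun j => k.2 j)
      (fun j => (k.2 j).2.le) hL s₀ l.1 (Q := X ^ (l.2 : ℕ))
      (by rw [natDegree_X_pow]; exact l.2.2) (mk k.1)).trans ?_
    have h1 : coeffNorm L₀ (c ^ 2 * N)
        ((X ^ (l.2 : ℕ) : (𝓞 F)[X]).map (τ.comp (algebraMap (𝓞 F) F))) ≤ (c ^ 2 * N) ^ L := by
      simp only [coeffNorm, Polynomial.map_pow, map_X, coeff_X_pow]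
      rw [Finset.sum_eq_single_of_mem (l.2 : ℕ) (Finset.mem_range.mpr l.2.2)
        (fun i _ hi => by simp [hi])]
      simpa using pow_le_pow_right₀ hZ (l.2.2.le.trans hL)
    have h2 : 0 ≤ coeffNorm L₀ (c ^ 2 * N)
        ((X ^ (l.2 : ℕ) : (𝓞 F)[X]).map (τ.comp (algebraMap (𝓞 F) F))) :=
      coeffNorm_nonneg (by positivity) _
    simp only [A]
    gcongr
    exact hmk k.1
  obtain ⟨ξ, hξ, hMξ, hbd⟩ := hS _ _ M A
    (by
      have : Nonempty (Fin T) := ⟨⟨0, hT⟩⟩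
      have : Nonempty (Fin N) := ⟨⟨0, hN⟩⟩
      exact Fintype.card_pos)
    (by simpa using hcard) hA hM
  set P : (J → Fin L) → (𝓞 F)[X] := fun l => ∑ i : Fin L₀, C (ξ (l, i)) * X ^ (i : ℕ)
  have hcoeff : ∀ l (i : Fin L₀), (P l).coeff i = ξ (l, i) := by
    intro l i
    simp only [P, finsetSum_coeff, coeff_C_mul, coeff_X_pow]
    rw [Finset.sum_eq_single i]
    · simp
    · intro k _ hk
      simp [Fin.val_inj, hk.symm]
    · simp
  have hdeg : ∀ l, (P l).natDegree < L₀ := by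
    intro l
    refine (natDegree_sum_le_of_forall_le (n := L₀ - 1) _ _ fun i _ =>
      (natDegree_C_mul_X_pow_le _ _).trans (by have := i.2; omega)).trans_lt (by omega)
  refine ⟨P, ?_, hdeg, ?_, ?_⟩
  · intro hP
    refine hξ (funext fun li => ?_)
    rw [← Prod.mk.eta (p := li), ← hcoeff, hP]
    simp
  · intro l i
    by_cases hi : i < L₀
    · have := hbd (l, ⟨i, hi⟩)
      rw [← hcoeff] at this
      simpa using this
    · rw [coeff_eq_zero_of_natDegree_lt ((hdeg l).trans_le (not_lt.mp hi)), map_zero]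
      have : house (0 : F) = 0 := by simp [house]
      rw [this]
      positivity
  · intro n hn m hm
    have hmm : mk (fun s => ⟨m.count s, (m.count_le_card s).trans_lt hm⟩) = m := by
      ext s
      simp [mk, Multiset.count_sum', Multiset.count_replicate]
    have h := congrFun hMξ (fun s => ⟨m.count s, (m.count_le_card s).trans_lt hm⟩,
      fun j => ⟨n j, hn j⟩)
    simp only [Matrix.mulVec, dotProduct, M, Matrix.of_apply, hmm, Pi.zero_apply,
      Fintype.sum_prod_type] at h
    rw [algVal, ← h]
    refine Finset.sum_congr rfl fun l _ => ?_
    simp only [P, map_sum, ← smul_eq_C_mul, map_smul, eval_finsetSum, eval_smul, smul_eq_mul,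
      Finset.sum_mul]
    exact Finset.sum_congr rfl fun i _ => by ring

/-- The upper bound for the first derivatives that do not vanish on the grid. -/
lemma norm_expEval_single_le {Λ J S : Type*} [Fintype Λ] [Fintype J] [Fintype S] [Nonempty J]
    [DecidableEq J] [DecidableEq S] {X : Λ → S → ℂ} {s₀ : S} {P : Λ → ℂ[X]} {y : J → S → ℂ}
    {A : S → J → ℂ} (hspan : ∀ s t, ∑ j, A s j * y j t = if s = t then 1 else 0)
    {c : ℝ} (hc : 1 ≤ c) (hJ : Fintype.card J ≤ c) (hS : Fintype.card S ≤ c)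
    {L N N' K L₀ : ℕ} (hL₀ : L₀ ≤ L) (hL : 1 ≤ L) (hN : N = Fintype.card J * N') (hN' : 1 ≤ N')
    (hX : ∀ l s, ‖X l s‖ ≤ c ^ 2 * L) (hy : ∀ j s, ‖y j s‖ ≤ c ^ 2) (hA : ∀ s j, ‖A s j‖ ≤ c)
    (hdeg : ∀ l, (P l).natDegree < L₀) {p : ℝ} (hp : ∀ l i, ‖(P l).coeff i‖ ≤ p)
    {ρ : ℝ} (hρ : 1 ≤ ρ)
    (hvan : ∀ n : J → ℕ, (∀ j, n j < N) → ∀ m : Multiset S, m.card < K →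
      expEval X s₀ P (∑ j, (n j : ℂ) • y j)
        (m.map fun s => symbol X s₀ (Pi.single s 1)).prod = 0)
    {n : J → ℕ} (hn : ∀ j, n j < N) (m : Multiset S) (hm : m.card = K) :
    ‖expEval X s₀ P (∑ j, (n j : ℂ) • y j)
        (m.map fun s => symbol X s₀ (Pi.single s 1)).prod‖ ≤
      (Fintype.card J * c) ^ K * ((K : ℝ) ^ K * ((ρ⁻¹) ^ (N' * K) * (Fintype.card Λ *
        ((2 * c ^ 5 * L) ^ K * (L * p * (5 * c ^ 3 * N * ρ) ^ L) *
          Real.exp (5 * c ^ 6 * N * ρ * L))))) := by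
  have hJ1 : 1 ≤ Fintype.card J := Fintype.card_pos
  have hN1 : 1 ≤ N := by rw [hN]; exact Nat.mul_pos hJ1 hN'
  have hNr : (1 : ℝ) ≤ N := by exact_mod_cast hN1
  have hLr : (1 : ℝ) ≤ L := by exact_mod_cast hL
  have hL₀r : (L₀ : ℝ) ≤ L := by exact_mod_cast hL₀
  have hc0 : 0 ≤ c := by linarith
  have hNρ : 1 ≤ N * ρ := one_le_mul_of_one_le_of_one_le hNr hρ
  have hsum : ∀ {f g : S → ℂ} {B₁ B₂ : ℝ}, (∀ s, ‖f s‖ ≤ B₁) → (∀ s, ‖g s‖ ≤ B₂) → 0 ≤ B₁ →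
      0 ≤ B₂ → ‖∑ s, f s * g s‖ ≤ c * (B₁ * B₂) := by
    intro f g B₁ B₂ hf hg h1 h2
    refine (norm_sum_le_of_le (f := fun s => f s * g s) (n := fun _ => B₁ * B₂) _
      fun s _ => ?_).trans ?_
    · rw [norm_mul]
      exact mul_le_mul (hf s) (hg s) (norm_nonneg _) h1
    · rw [Finset.sum_const, Finset.card_univ, nsmul_eq_mul]
      gcongr
  have hys : ∀ j, symbol X s₀ (y j) = ∑ s, y j s • symbol X s₀ (Pi.single s 1) := by
    intro j
    rw [← symbol_sum]
    congr 1
    ext t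
    simp [Pi.single_apply]
  have hsy : ∀ s, symbol X s₀ (Pi.single s 1) = ∑ j, A s j • symbol X s₀ (y j) := by
    intro s
    rw [← symbol_sum]
    congr 1
    ext t
    simp [Pi.single_apply, hspan, eq_comm]
  refine norm_map_prod_le (u := fun j => symbol X s₀ (y j)) hsy hA hc0 m
    (expEval X s₀ P (∑ j, (n j : ℂ) • y j)) (fun m' hm' => ?_) |>.trans_eq (by rw [hm])
  have hvan' : ∀ n : J → ℕ, (∀ j, n j < N) → ∀ m : Multiset J, m.card < K →
      expEval X s₀ P (∑ j, (n j : ℂ) • y j) (m.map fun j => symbol X s₀ (y j)).prod = 0 := by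
    intro n hn m hm
    have := norm_map_prod_le (u := fun s => symbol X s₀ (Pi.single s 1)) (a := y) hys
      (A := c ^ 2) hy (by positivity) m (expEval X s₀ P (∑ j, (n j : ℂ) • y j)) (ε := 0)
      (fun m' hm' => by rw [hvan n hn m' (by omega), norm_zero])
    simpa using this
  have hG : ∀ n : J → ℕ, (∀ j, n j < N) → ∀ (j : J) (t : ℂ), ‖t‖ ≤ 4 * N * ρ →
      ∀ m : Multiset J, m.card ≤ K → ‖expEval X s₀ P ((∑ j, (n j : ℂ) • y j) + t • y j)
        (m.map fun j => symbol X s₀ (y j)).prod‖ ≤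
      Fintype.card Λ * ((2 * c ^ 5 * L) ^ K * (L * p * (5 * c ^ 3 * N * ρ) ^ L) *
          Real.exp (5 * c ^ 6 * N * ρ * L)) := by
    intro n hn j t ht m hmK
    have hz : ∀ s, ‖((∑ j, (n j : ℂ) • y j) + t • y j) s‖ ≤ 5 * c ^ 3 * N * ρ := by
      intro s
      have h1 : ‖∑ j, (n j : ℂ) * y j s‖ ≤ Fintype.card J * (N * c ^ 2) := by
        refine (norm_sum_le_of_le (n := fun _ => N * c ^ 2) _ fun j _ => ?_).trans_eq ?_
        · rw [norm_mul, Complex.norm_natCast]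
          have : (n j : ℝ) ≤ N := by exact_mod_cast (hn j).le
          have := hy j s
          gcongr
        · simp
      have h2 : ‖t * y j s‖ ≤ 4 * N * ρ * c ^ 2 := by
        rw [norm_mul]
        have := hy j s
        gcongr
      simp only [Pi.add_apply, Finset.sum_apply, Pi.smul_apply, smul_eq_mul]
      refine (norm_add_le_of_le h1 h2).trans ?_
      calc Fintype.card J * (N * c ^ 2) + 4 * N * ρ * c ^ 2
          ≤ c * (N * c ^ 2) * ρ + c * (4 * N * ρ * c ^ 2) := by
            refine add_le_add ?_ (le_mul_of_one_le_left (by positivity) hc)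
            rw [← mul_one (_ * _ : ℝ)]
            gcongr
        _ = 5 * c ^ 3 * N * ρ := by ring
    have hZ : 1 ≤ 5 * c ^ 3 * N * ρ := by
      rw [mul_assoc]
      exact one_le_mul_of_one_le_of_one_le (by nlinarith [one_le_pow₀ hc (n := 3)]) hNρ
    refine (norm_expEval_le X s₀ P (L := L₀) (Z := 5 * c ^ 3 * N * ρ)
      (Q := L * p * (5 * c ^ 3 * N * ρ) ^ L) (E := 5 * c ^ 6 * N * ρ * L) (A := c ^ 5 * L)
      (B := c ^ 2) hdeg hZ (fun l => coeffNorm_le hZ hL₀ (hp l)) (hz s₀) (fun l => ?_) y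
      (fun l j => ?_) (fun j => hy j s₀) (by positivity) m).trans ?_
    · refine (hsum (hX l) hz (by positivity) (by positivity)).trans_eq ?_
      ring
    · refine (hsum (hX l) (hy j) (by positivity) (by positivity)).trans_eq ?_
      ring
    · have hp0 : 0 ≤ p ∨ IsEmpty Λ := by
        by_cases h : Nonempty Λ
        · exact Or.inl ((norm_nonneg _).trans (hp h.some 0))
        · exact Or.inr (not_nonempty_iff.mp h)
      rcases hp0 with hp0 | hΛ
      · have h5 : c ^ 2 ≤ c ^ 5 := pow_le_pow_right₀ hc (by norm_num)
        have h6 : c ^ 5 * L + c ^ 2 * L₀ ≤ 2 * c ^ 5 * L := by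
          have : c ^ 2 * L₀ ≤ c ^ 5 * L := by gcongr
          linarith
        have h7 : 1 ≤ 2 * c ^ 5 * L := by nlinarith [one_le_pow₀ hc (n := 5)]
        have h8 : (c ^ 5 * L + c ^ 2 * L₀) ^ m.card ≤ (2 * c ^ 5 * L) ^ K :=
          (pow_le_pow_left₀ (by positivity) h6 _).trans (pow_le_pow_right₀ h7 hmK)
        gcongr
      · simp
  obtain ⟨k, hkK, hKk, hk⟩ := norm_expEval_grid_le X s₀ P (R := 4 * N * ρ) (K := K)
    (G := Fintype.card Λ * ((2 * c ^ 5 * L) ^ K * (L * p * (5 * c ^ 3 * N * ρ) ^ L) *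
          Real.exp (5 * c ^ 6 * N * ρ * L))) (by nlinarith) hvan' hG hn m' (hm'.trans hm)
  refine hk.trans ?_
  have h4 : 4 * (N : ℝ) / (4 * N * ρ) = ρ⁻¹ := by field_simp
  have hexp : N' * K ≤ N * k := by
    rw [hN, mul_comm (Fintype.card J), mul_assoc]
    gcongr
  rw [h4]
  have hp0 : 0 ≤ p ∨ IsEmpty Λ := by
    by_cases h : Nonempty Λ
    · exact Or.inl ((norm_nonneg _).trans (hp h.some 0))
    · exact Or.inr (not_nonempty_iff.mp h)
  rcases hp0 with hp0 | hΛ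
  · have hρN : ρ⁻¹ ^ (N * k) ≤ ρ⁻¹ ^ (N' * K) :=
      pow_le_pow_of_le_one (by positivity) (inv_le_one_of_one_le₀ hρ) hexp
    have hfac : (k.factorial : ℝ) ≤ (K : ℝ) ^ K := by
      exact_mod_cast (Nat.factorial_le hkK).trans K.factorial_le_pow
    refine mul_le_mul hfac (mul_le_mul_of_nonneg_right hρN ?_) ?_ ?_ <;> positivity
  · simp

end Construction

section Parameters

set_option maxHeartbeats 1000000 in
/-- The choice of parameters for which the upper and lower bounds contradict each other. -/
lemma exists_parameters {d r f D : ℕ} {c cS : ℝ} (hd : 1 ≤ d) (hr : r + 1 ≤ D) (hdD : d ≤ D)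
    (hc : 1 ≤ c) (hcS : 1 ≤ cS) :
    ∃ N' N L T : ℕ, 1 ≤ N' ∧ N = d * N' ∧ 1 ≤ T ∧ 1 ≤ L ∧ 2 * (T ^ r * N ^ d) ≤ L ^ D ∧
      ∀ K : ℕ, T ≤ K → ∃ ρ : ℝ, 1 ≤ ρ ∧ ∀ p : ℝ,
        p = cS * ((L : ℝ) ^ D * ((2 * c ^ 2 * L) ^ (r * T) * (c ^ 2 * N) ^ L *
          c ^ (d ^ 2 * (L * N)))) →
        (c ^ (d ^ 2 * (L * N)) * ((d * c) ^ K * ((K : ℝ) ^ K * ((ρ⁻¹) ^ (N' * K) * ((L : ℝ) ^ d *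
          ((2 * c ^ 5 * L) ^ K * (L * p * (5 * c ^ 3 * N * ρ) ^ L) *
            Real.exp (5 * c ^ 6 * N * ρ * L))))))) *
        ((L : ℝ) ^ d * ((2 * c ^ 2 * L) ^ K * (L * p * (c ^ 2 * N) ^ L) *
          c ^ (d ^ 2 * (L * N)))) ^ (f - 1) < 1 := by
  obtain ⟨e₁, he₁⟩ : ∃ k : ℕ, k = 1 + (D * D + (D * r + 1 + 1)) := ⟨_, rfl⟩
  obtain ⟨e₂, he₂⟩ : ∃ k : ℕ, k = D * d + (D + (D + e₁ + 1) + 1) := ⟨_, rfl⟩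
  obtain ⟨e₃, he₃⟩ : ∃ k : ℕ, k = 1 + (1 + (D + (D * d + (D + (D + e₁ + 2) + 1)))) := ⟨_, rfl⟩
  obtain ⟨N', hN'⟩ : ∃ k : ℕ, k = e₃ + e₂ * (f - 1) + 1 := ⟨_, rfl⟩
  obtain ⟨N, hN⟩ : ∃ k : ℕ, k = d * N' := ⟨_, rfl⟩
  have hN'1 : 1 ≤ N' := by omega
  have hN1 : 1 ≤ N := by
    rw [hN]
    exact Nat.mul_pos hd hN'1
  have hNr : (1 : ℝ) ≤ N := by exact_mod_cast hN1
  have hd1 : (1 : ℝ) ≤ d := by exact_mod_cast hd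
  obtain ⟨M, hM⟩ := exists_nat_ge (2 + cS + d * c + 4 * c ^ 5 * N + 5 * c ^ 3 * N +
    c ^ (d ^ 2 * N) + Real.exp (10 * c ^ 6 * N ^ 2))
  have hp1 : 0 ≤ (d : ℝ) * c := by positivity
  have hp2 : 0 ≤ 4 * c ^ 5 * N := by positivity
  have hp3 : 0 ≤ 5 * c ^ 3 * N := by positivity
  have hp4 : 0 ≤ c ^ (d ^ 2 * N) := by positivity
  have hp5 : 0 ≤ Real.exp (10 * c ^ 6 * N ^ 2) := by positivity
  have hM1r : (1 : ℝ) ≤ M := by linarith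
  have hM1 : 1 ≤ M := by exact_mod_cast hM1r
  obtain ⟨L, hL⟩ : ∃ k : ℕ, k = 2 * N * M ^ (D - 1) := ⟨_, rfl⟩
  have hL1 : 1 ≤ L := by
    rw [hL]
    exact Nat.mul_pos (by omega) (Nat.pow_pos hM1)
  have hLr : (1 : ℝ) ≤ L := by exact_mod_cast hL1
  refine ⟨N', N, L, M ^ D, hN'1, hN, Nat.pow_pos hM1, hL1, ?_, fun K hK => ?_⟩
  · calc 2 * ((M ^ D) ^ r * N ^ d) ≤ 2 ^ D * (M ^ (D * (D - 1)) * N ^ D) := by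
          rw [← pow_mul]
          have h2 : 2 ≤ 2 ^ D := Nat.le_self_pow (by omega) 2
          have h3 : D * r ≤ D * (D - 1) := Nat.mul_le_mul_left _ (by omega)
          gcongr
      _ = L ^ D := by
          rw [hL, mul_pow, mul_pow, ← pow_mul, mul_comm (D - 1)]
          ring
  have hD0 : D ≠ 0 := by omega
  obtain ⟨ρ, hρ0, hρD⟩ : ∃ ρ : ℝ, 0 ≤ ρ ∧ ρ ^ D = K :=
    ⟨(K : ℝ) ^ ((D : ℝ)⁻¹), Real.rpow_nonneg (Nat.cast_nonneg _) _,
      Real.rpow_inv_natCast_pow (Nat.cast_nonneg _) hD0⟩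
  have hMρ : (M : ℝ) ≤ ρ := by
    refine le_of_pow_le_pow_left₀ hD0 hρ0 ?_
    rw [hρD]
    exact_mod_cast hK
  have hρ1 : 1 ≤ ρ := hM1r.trans hMρ
  have hρ2 : 1 < ρ := by linarith
  have hK0 : 1 ≤ K := (Nat.pow_pos hM1).trans_le hK
  have hLρ : (L : ℝ) ≤ 2 * N * ρ ^ (D - 1) := by
    rw [hL]
    push_cast
    gcongr
  have hρD' : ρ * ρ ^ (D - 1) = K := by
    rw [← pow_succ', Nat.sub_add_cancel (by omega), hρD]
  have hc5 : 1 ≤ c ^ 5 := one_le_pow₀ hc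
  have hbig : 2 * c ^ 5 * L ≤ ρ ^ D := by
    calc 2 * c ^ 5 * L ≤ 2 * c ^ 5 * (2 * N * ρ ^ (D - 1)) := by gcongr
      _ = (4 * c ^ 5 * N) * ρ ^ (D - 1) := by ring
      _ ≤ ρ * ρ ^ (D - 1) := by
        gcongr
        linarith
      _ = ρ ^ D := by rw [hρD', hρD]
  have hbig2 : 2 * c ^ 2 * L ≤ ρ ^ D := by
    refine le_trans ?_ hbig
    have : c ^ 2 ≤ c ^ 5 := pow_le_pow_right₀ hc (by norm_num)
    gcongr
  have hLD : (L : ℝ) ≤ ρ ^ D := by nlinarith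
  have hLK : L ≤ K := by
    have : (L : ℝ) ≤ K := hLD.trans_eq hρD
    exact_mod_cast this
  have hDK : ∀ k : ℕ, (L : ℝ) ^ k ≤ ρ ^ (D * k * K) := by
    intro k
    calc (L : ℝ) ^ k ≤ (ρ ^ D) ^ k := by gcongr
      _ = ρ ^ (D * k) := by rw [pow_mul]
      _ ≤ ρ ^ (D * k * K) := pow_le_pow_right₀ hρ1 (Nat.le_mul_of_pos_right _ hK0)
  have hLDK : (L : ℝ) ≤ ρ ^ (D * K) := by simpa using hDK 1
  have hself : ρ ≤ ρ ^ K := by simpa using pow_le_pow_right₀ hρ1 hK0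
  have hcSK : cS ≤ ρ ^ K := le_trans (by linarith) hself
  have hdcK : (d * c) ^ K ≤ ρ ^ K := by
    gcongr
    linarith
  have hweight : c ^ (d ^ 2 * (L * N)) ≤ ρ ^ K := by
    calc c ^ (d ^ 2 * (L * N)) = (c ^ (d ^ 2 * N)) ^ L := by
          rw [← pow_mul]
          congr 1
          ring
      _ ≤ ρ ^ L := by
          gcongr
          linarith
      _ ≤ ρ ^ K := pow_le_pow_right₀ hρ1 hLK
  have hcN : c ^ 2 * N ≤ ρ := by
    have : c ^ 2 ≤ c ^ 5 := pow_le_pow_right₀ hc (by norm_num)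
    have : c ^ 2 * N ≤ c ^ 5 * N := by gcongr
    nlinarith
  have hcNL : (c ^ 2 * N) ^ L ≤ ρ ^ K := by
    calc (c ^ 2 * N) ^ L ≤ ρ ^ L := by gcongr
      _ ≤ ρ ^ K := pow_le_pow_right₀ hρ1 hLK
  have hcNρ : (5 * c ^ 3 * N * ρ) ^ L ≤ ρ ^ (2 * K) := by
    calc (5 * c ^ 3 * N * ρ) ^ L ≤ (ρ * ρ) ^ L := by
          gcongr
          linarith
      _ = ρ ^ (2 * L) := by rw [← pow_two, ← pow_mul]
      _ ≤ ρ ^ (2 * K) := pow_le_pow_right₀ hρ1 (by omega)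
  have hexp : Real.exp (5 * c ^ 6 * N * ρ * L) ≤ ρ ^ K := by
    have h1 : 5 * c ^ 6 * N * ρ * L ≤ K * (10 * c ^ 6 * N ^ 2) := by
      calc 5 * c ^ 6 * N * ρ * L ≤ 5 * c ^ 6 * N * ρ * (2 * N * ρ ^ (D - 1)) := by gcongr
        _ = (ρ * ρ ^ (D - 1)) * (10 * c ^ 6 * N ^ 2) := by ring
        _ = K * (10 * c ^ 6 * N ^ 2) := by rw [hρD']
    calc Real.exp (5 * c ^ 6 * N * ρ * L) ≤ Real.exp (K * (10 * c ^ 6 * N ^ 2)) := by gcongr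
      _ = Real.exp (10 * c ^ 6 * N ^ 2) ^ K := Real.exp_nat_mul _ _
      _ ≤ ρ ^ K := by
          gcongr
          linarith
  have h2K : (2 * c ^ 2 * (L : ℝ)) ^ K ≤ ρ ^ (D * K) := by
    rw [pow_mul]
    gcongr
  have h5K : (2 * c ^ 5 * (L : ℝ)) ^ K ≤ ρ ^ (D * K) := by
    rw [pow_mul]
    gcongr
  have h2T : (2 * c ^ 2 * (L : ℝ)) ^ (r * M ^ D) ≤ ρ ^ (D * r * K) := by
    calc (2 * c ^ 2 * (L : ℝ)) ^ (r * M ^ D) ≤ (ρ ^ D) ^ (r * M ^ D) := by gcongr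
      _ = ρ ^ (D * r * M ^ D) := by rw [← pow_mul, mul_assoc]
      _ ≤ ρ ^ (D * r * K) := pow_le_pow_right₀ hρ1 (Nat.mul_le_mul_left _ hK)
  have hKK : (K : ℝ) ^ K = ρ ^ (D * K) := by rw [pow_mul, hρD]
  refine ⟨ρ, hρ1, fun p hp => ?_⟩
  have hp0 : 0 ≤ p := by rw [hp]; positivity
  have hpK : p ≤ ρ ^ (e₁ * K) := by
    rw [hp]
    calc _ ≤ ρ ^ K * (ρ ^ (D * D * K) * (ρ ^ (D * r * K) * ρ ^ K * ρ ^ K)) := by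
          gcongr
          exact hDK D
      _ = ρ ^ (e₁ * K) := by
          simp only [← pow_add]
          congr 1
          rw [he₁]
          ring
  have hH : (L : ℝ) ^ d * ((2 * c ^ 2 * L) ^ K * (L * p * (c ^ 2 * N) ^ L) *
      c ^ (d ^ 2 * (L * N))) ≤ ρ ^ (e₂ * K) := by
    calc _ ≤ ρ ^ (D * d * K) * (ρ ^ (D * K) * (ρ ^ (D * K) * ρ ^ (e₁ * K) * ρ ^ K) * ρ ^ K) := by
          gcongr
          exact hDK d
      _ = ρ ^ (e₂ * K) := by
          simp only [← pow_add]
          congr 1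
          rw [he₂]
          ring
  have hU : c ^ (d ^ 2 * (L * N)) * ((d * c) ^ K * ((K : ℝ) ^ K * ((ρ⁻¹) ^ (N' * K) *
      ((L : ℝ) ^ d * ((2 * c ^ 5 * L) ^ K * (L * p * (5 * c ^ 3 * N * ρ) ^ L) *
        Real.exp (5 * c ^ 6 * N * ρ * L)))))) ≤ (ρ⁻¹) ^ (N' * K) * ρ ^ (e₃ * K) := by
    calc _ ≤ ρ ^ K * (ρ ^ K * (ρ ^ (D * K) * ((ρ⁻¹) ^ (N' * K) * (ρ ^ (D * d * K) *
            (ρ ^ (D * K) * (ρ ^ (D * K) * ρ ^ (e₁ * K) * ρ ^ (2 * K)) * ρ ^ K))))) := by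
          rw [hKK]
          gcongr
          exact hDK d
      _ = (ρ⁻¹) ^ (N' * K) * (ρ ^ K * (ρ ^ K * (ρ ^ (D * K) * (ρ ^ (D * d * K) *
            (ρ ^ (D * K) * (ρ ^ (D * K) * ρ ^ (e₁ * K) * ρ ^ (2 * K)) * ρ ^ K))))) := by ring
      _ = (ρ⁻¹) ^ (N' * K) * ρ ^ (e₃ * K) := by
          simp only [← pow_add]
          congr 2
          rw [he₃]
          ring
  calc _ ≤ ((ρ⁻¹) ^ (N' * K) * ρ ^ (e₃ * K)) * (ρ ^ (e₂ * K)) ^ (f - 1) := by gcongr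
    _ = (ρ⁻¹) ^ (N' * K) * ρ ^ ((e₃ + e₂ * (f - 1)) * K) := by
        rw [← pow_mul, mul_assoc, ← pow_add]
        congr 2
        ring
    _ = (ρ⁻¹) ^ K := by
        rw [hN', add_mul _ 1, pow_add, mul_right_comm, ← mul_pow, inv_mul_cancel₀ (by positivity),
          one_pow, one_mul, one_mul]
    _ < 1 := pow_lt_one₀ (by positivity) (inv_lt_one_of_one_lt₀ hρ2) (by omega)

end Parameters

section Core

open Polynomial NumberField

/-- A common bound for finitely many constants. -/
lemma exists_common_bound {F : Type*} [Field F] [NumberField F] {J S : Type} [Fintype J]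
    [Fintype S] (x : S → J → 𝓞 F) (θ : J → 𝓞 F) (a : J → J → 𝓞 F) (b : ℕ) (w : S → ℂ)
    (A : S → J → ℂ) : ∃ c : ℝ, 1 ≤ c ∧ Fintype.card J ≤ c ∧ Fintype.card S ≤ c ∧
      (∀ s j, house (algebraMap (𝓞 F) F (x s j)) ≤ c) ∧
      (∀ j, house (algebraMap (𝓞 F) F (θ j)) ≤ c) ∧
      (∀ i j, house (algebraMap (𝓞 F) F (a i j)) ≤ c) ∧ b ≤ c ∧ (∀ s, ‖w s‖ ≤ c) ∧
      ∀ s j, ‖A s j‖ ≤ c := by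
  obtain ⟨c₁, h₁⟩ := (Set.finite_range fun k : S × J =>
    house (algebraMap (𝓞 F) F (x k.1 k.2))).bddAbove
  obtain ⟨c₂, h₂⟩ := (Set.finite_range fun j => house (algebraMap (𝓞 F) F (θ j))).bddAbove
  obtain ⟨c₃, h₃⟩ := (Set.finite_range fun k : J × J =>
    house (algebraMap (𝓞 F) F (a k.1 k.2))).bddAbove
  obtain ⟨c₄, h₄⟩ := (Set.finite_range fun s => ‖w s‖).bddAbove
  obtain ⟨c₅, h₅⟩ := (Set.finite_range fun k : S × J => ‖A k.1 k.2‖).bddAbove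
  simp only [mem_upperBounds, Set.forall_mem_range, Prod.forall] at h₁ h₂ h₃ h₄ h₅
  have hJ : (0 : ℝ) ≤ Fintype.card J := Nat.cast_nonneg _
  have hS : (0 : ℝ) ≤ Fintype.card S := Nat.cast_nonneg _
  have hb : (0 : ℝ) ≤ b := Nat.cast_nonneg _
  have g₁ := le_abs_self c₁
  have g₂ := le_abs_self c₂
  have g₃ := le_abs_self c₃
  have g₄ := le_abs_self c₄
  have g₅ := le_abs_self c₅
  have k₁ := abs_nonneg c₁
  have k₂ := abs_nonneg c₂
  have k₃ := abs_nonneg c₃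
  have k₄ := abs_nonneg c₄
  have k₅ := abs_nonneg c₅
  refine ⟨1 + Fintype.card J + Fintype.card S + b + |c₁| + |c₂| + |c₃| + |c₄| + |c₅|,
    by linarith, by linarith, by linarith, fun s j => ?_, fun j => ?_, fun i j => ?_,
    by linarith, fun s => ?_, fun s j => ?_⟩
  · linarith [h₁ s j]
  · linarith [h₂ j]
  · linarith [h₃ i j]
  · linarith [h₄ s]
  · linarith [h₅ s j]

/-- An exponential polynomial with nonzero coefficients has a nonvanishing derivative at `0`. -/
lemma exists_algVal_zero_ne_zero {R J S : Type*} [CommRing R] [Fintype J] [Fintype S]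
    [DecidableEq J] [DecidableEq S] {φ : R →+* ℂ} (hφ : Function.Injective φ) {x : S → J → R}
    {s₀ : S} (hinj : ∀ k : J → ℤ, ∑ j, (k j : R) * x s₀ j = 0 → k = 0) (θ : J → R)
    (a : J → J → R) {b N L : ℕ} (hb : b ≠ 0) {P : (J → Fin L) → R[X]} (hP : P ≠ 0) :
    ∃ i : ℕ, algVal θ a b N P 0
      ((Multiset.replicate i s₀).map fun s => algSymbol (L := L) x s₀ s).prod ≠ 0 := by
  have hc : Function.Injective fun l : J → Fin L => φ (freq x l s₀) := by
    intro l l' h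
    have h1 : freq x l s₀ = freq x l' s₀ := hφ h
    have h2 := hinj (fun j => ((l j : ℕ) : ℤ) - ((l' j : ℕ) : ℤ)) (by
      simp only [freq] at h1
      push_cast
      simp only [sub_mul, Finset.sum_sub_distrib, h1, sub_self])
    funext j
    have h3 := congrFun h2 j
    simp only [Pi.zero_apply] at h3
    exact Fin.ext (by omega)
  have hPφ : (fun l => (P l).map φ) ≠ 0 := by
    intro h
    refine hP (funext fun l => Polynomial.map_injective φ hφ ?_)
    simpa using congrFun h l
  obtain ⟨i, hi⟩ := exists_sum_diffOp_eval_zero_ne_zero hc hPφ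
  refine ⟨i, fun h => hi ?_⟩
  have hw : ∀ l : J → Fin L, weight a b N l 0 = (b : R) ^ (Fintype.card J ^ 2 * (L * N)) := by
    intro l
    simp only [weight, Pi.zero_apply, mul_zero, pow_zero, one_mul, Nat.sub_zero,
      Finset.prod_const, Finset.card_univ, ← pow_mul]
    congr 1
    ring
  have h1 := congrArg φ h
  simp only [algVal, hw, Pi.zero_apply, Nat.cast_zero, zero_mul, Finset.sum_const_zero, map_sum,
    map_mul, map_zero, ← Finset.sum_mul, map_pow, map_natCast] at h1
  have h2 := (mul_eq_zero.mp h1).resolve_right (pow_ne_zero _ (by exact_mod_cast hb))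
  refine Eq.trans ?_ h2
  refine Finset.sum_congr rfl fun l _ => ?_
  rw [← eval_zero_map, map_diffOp, map_algSymbol_prod]
  simp

/-- The transcendence statement behind Baker's theorem. -/
theorem false_of_exp_mem_field {F : Type*} [Field F] [NumberField F] (ι : F →+* ℂ)
    {J S : Type} [Fintype J] [Fintype S] [DecidableEq J] [DecidableEq S]
    (x : S → J → 𝓞 F) (w : S → ℂ) (s₀ : S) (θ : J → 𝓞 F) (a : J → J → 𝓞 F) {b : ℕ}
    (hb : b ≠ 0)
    (hexp : ∀ i j, b * Complex.exp (∑ s, ι (x s i) * (ι (x s j) * w s)) = ι (a i j))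
    (hinj : ∀ k : J → ℤ, ∑ j, (k j : 𝓞 F) * x s₀ j = 0 → k = 0)
    {A : S → J → ℂ} (hspan : ∀ s t, ∑ j, A s j * (ι (x t j) * w t) = if s = t then 1 else 0)
    (hcard : Fintype.card S < Fintype.card J ∨
      (Fintype.card S ≤ Fintype.card J ∧ ∀ j, ι (θ j) = ι (x s₀ j) * w s₀)) : False := by
  obtain ⟨c, hc, hJ, hS, hx, hθ, ha, hbc, hw, hA⟩ := exists_common_bound x θ a b w A
  obtain ⟨cS, hcS, haux⟩ := exists_auxiliary (x := x) s₀ hc hJ hx hθ ha hbc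
  set φ : 𝓞 F →+* ℂ := ι.comp (algebraMap (𝓞 F) F)
  have hφ : Function.Injective φ := ι.injective.comp RingOfIntegers.coe_injective
  have hS1 : 1 ≤ Fintype.card S := Fintype.card_pos_iff.mpr ⟨s₀⟩
  have hJ1 : 1 ≤ Fintype.card J := by rcases hcard with h | h <;> omega
  have : Nonempty J := Fintype.card_pos_iff.mp hJ1
  obtain ⟨D, δ, hD, hr, hdD, hδ⟩ : ∃ D δ : ℕ, Fintype.card J + δ = D ∧ Fintype.card S + 1 ≤ D ∧
      δ ≤ 1 ∧ (δ = 0 ∨ ∀ j, φ (θ j) = φ (x s₀ j) * w s₀) := by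
    rcases hcard with h | ⟨h, h'⟩
    · exact ⟨_, 0, rfl, by omega, by omega, Or.inl rfl⟩
    · exact ⟨_, 1, rfl, by omega, by omega, Or.inr h'⟩
  obtain ⟨N', N, L, T, hN', hN, hT, hL, hTL, hpar⟩ := exists_parameters (d := Fintype.card J)
    (f := Module.finrank ℚ F) hJ1 hr (by omega) hc hcS
  have hN1 : 1 ≤ N := by
    rw [hN]
    exact Nat.mul_pos hJ1 hN'
  have hL₀L : L ^ δ ≤ L := by simpa using Nat.pow_le_pow_right hL hdD
  obtain ⟨P, hP, hdeg, hcoeff, hvan⟩ := haux L N T (L ^ δ) hN1 hT (Nat.pow_pos hL) hL₀L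
    (by rwa [← pow_add, hD])
  have hL₀ : L ^ δ = 1 ∨ ∀ j, φ (θ j) = φ (x s₀ j) * w s₀ := by
    rcases hδ with h | h
    · exact Or.inl (by rw [h, pow_zero])
    · exact Or.inr h
  set p : ℝ := cS * ((L : ℝ) ^ D * ((2 * c ^ 2 * L) ^ (Fintype.card S * T) *
    (c ^ 2 * N) ^ L * c ^ (Fintype.card J ^ 2 * (L * N)))) with hp
  have hcoeff' : ∀ l i, house (algebraMap (𝓞 F) F ((P l).coeff i)) ≤ p := by
    intro l i
    refine (hcoeff l i).trans_eq ?_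
    rw [hp, ← hD, pow_add]
    push_cast
    ring
  classical
  have hex : ∃ K, ∃ n : J → ℕ, (∀ j, n j < N) ∧ ∃ m : Multiset S, m.card = K ∧
      algVal θ a b N P n (m.map fun s => algSymbol (L := L) x s₀ s).prod ≠ 0 := by
    obtain ⟨i, hi⟩ := exists_algVal_zero_ne_zero (N := N) hφ hinj θ a hb hP
    exact ⟨i, 0, fun j => hN1, _, Multiset.card_replicate _ _, hi⟩
  obtain ⟨n, hn, m, hm, hne⟩ := Nat.find_spec hex
  have hmin : ∀ n : J → ℕ, (∀ j, n j < N) → ∀ m : Multiset S, m.card < Nat.find hex →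
      algVal θ a b N P n (m.map fun s => algSymbol (L := L) x s₀ s).prod = 0 := by
    intro n hn m hm
    by_contra h
    exact Nat.find_min hex hm ⟨n, hn, m, rfl, h⟩
  set K := Nat.find hex
  have hTK : T ≤ K := by
    by_contra! h
    exact hne (hvan n hn m (by omega))
  obtain ⟨ρ, hρ, hlt⟩ := hpar K hTK
  refine absurd (hlt p hp) (not_lt.mpr ?_)
  have hφx : ∀ s j, ‖φ (x s j)‖ ≤ c := fun s j => house_le_iff.mp (hx s j) ι
  have hval := fun (n : J → ℕ) (hn : ∀ j, n j < N) m =>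
    map_algVal (φ := φ) (x := x) (s₀ := s₀) (w := w)
    (θ := θ) (a := a) (N := N) hb hexp hL₀ hdeg (fun j => (hn j).le) m
  have hb0 : (b : ℂ) ≠ 0 := by exact_mod_cast hb
  have hupper := norm_expEval_single_le (X := fun l s => φ (freq x l s)) (s₀ := s₀)
    (P := fun l => (P l).map φ) (y := fun j s => φ (x s j) * w s) hspan hc hJ hS hL₀L hL hN hN'
    (norm_freq_le hJ hφx) (fun j s => ?_) hA (fun l => natDegree_map_le.trans_lt (hdeg l))
    (p := p) (fun l i => by rw [coeff_map]; exact house_le_iff.mp (hcoeff' l i) ι) hρ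
    (fun n hn m hm => ?_) hn m hm
  · have hhouse : house (algebraMap (𝓞 F) F (algVal θ a b N P n
        (m.map fun s => algSymbol (L := L) x s₀ s).prod)) ≤
        (L : ℝ) ^ Fintype.card J * ((2 * c ^ 2 * L) ^ K * (L * p * (c ^ 2 * N) ^ L) *
        c ^ (Fintype.card J ^ 2 * (L * N))) := by
      rw [house_le_iff]
      intro τ
      rw [← hm]
      exact norm_algVal_le (τ := τ.comp (algebraMap (𝓞 F) F)) hc hJ
        (fun s j => house_le_iff.mp (hx s j) τ) (fun j => house_le_iff.mp (hθ j) τ)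
        (fun i j => house_le_iff.mp (ha i j) τ) hbc hN1 (fun j => (hn j).le) hL₀L s₀ hdeg
        (fun l i => house_le_iff.mp (hcoeff' l i) τ) m
    refine (one_le_norm_mul_pow_house hne ι hhouse).trans ?_
    have hp0 : 0 ≤ p := by rw [hp]; positivity
    refine mul_le_mul_of_nonneg_right ?_ (by positivity)
    change ‖φ _‖ ≤ _
    rw [hval n hn m, norm_mul, norm_pow, Complex.norm_natCast]
    refine mul_le_mul (by gcongr) (hupper.trans_eq ?_) (norm_nonneg _) (by positivity)
    simp
  · rw [norm_mul, pow_two]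
    exact mul_le_mul (hφx s j) (hw s) (norm_nonneg _) (by linarith)
  · have h := hval n hn m
    rw [hmin n hn m hm, map_zero] at h
    exact (mul_eq_zero.mp h.symm).resolve_left (pow_ne_zero _ hb0)

end Core

section Descent

open NumberField

/-- Dedekind's independence of characters, as the existence of a dual family. -/
lemma exists_dual_of_injective {R J S : Type*} [CommRing R] [Fintype J] [Fintype S]
    [DecidableEq J] [DecidableEq S] (η : Module.Basis J ℤ R) (τ : S → R →+* ℂ)
    (hτ : Function.Injective τ) (w : S → ℂ) (hw : ∀ s, w s ≠ 0) :
    ∃ A : S → J → ℂ, ∀ s t, ∑ j, A s j * (τ t (η j) * w t) = if s = t then 1 else 0 := by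
  let M : (S → ℂ) →ₗ[ℂ] (J → ℂ) := Matrix.mulVecLin (Matrix.of fun j t => τ t (η j) * w t)
  have hM : ∀ c j, M c j = ∑ t, τ t (η j) * w t * c t := fun c j => rfl
  have hker : LinearMap.ker M = ⊥ := by
    refine LinearMap.ker_eq_bot'.2 fun c hc => ?_
    have hind : LinearIndependent ℂ fun s => (fun r => τ s r : R → ℂ) :=
      (linearIndependent_monoidHom R ℂ).comp (fun s => (τ s : R →* ℂ)) fun s t h =>
        hτ (RingHom.ext fun r => DFunLike.congr_fun h r)
    have hzero : (∑ t, (w t * c t) • (τ t : R →+ ℂ)).toIntLinearMap = 0 := by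
      refine η.ext fun j => ?_
      have := congrFun hc j
      rw [hM] at this
      simp only [AddMonoidHom.coe_toIntLinearMap, AddMonoidHom.finsetSum_apply,
        LinearMap.zero_apply]
      rw [Pi.zero_apply] at this
      rw [← this]
      refine Finset.sum_congr rfl fun t _ => ?_
      simp only [AddMonoidHom.smul_apply, smul_eq_mul, AddMonoidHom.coe_coe]
      ring
    have hcoef := Fintype.linearIndependent_iff.1 hind (fun t => w t * c t) <| by
      funext r
      have := LinearMap.congr_fun hzero r
      simpa [AddMonoidHom.finsetSum_apply] using this
    funext t
    exact (mul_eq_zero.1 (hcoef t)).resolve_left (hw t)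
  obtain ⟨g, hg⟩ := M.exists_leftInverse_of_injective hker
  refine ⟨fun s j => g (Pi.single j 1) s, fun s t => ?_⟩
  have h := congrFun (LinearMap.congr_fun hg (Pi.single t 1)) s
  rw [LinearMap.comp_apply, LinearMap.id_apply, Pi.single_apply] at h
  rw [← h, ← Finset.univ_sum_single (M (Pi.single t 1)), map_sum, Finset.sum_apply]
  refine Finset.sum_congr rfl fun j _ => ?_
  have : M (Pi.single t 1) j = τ t (η j) * w t := by simp [hM, Pi.single_apply]
  rw [this, show (Pi.single j (τ t (η j) * w t) : J → ℂ)
    = (τ t (η j) * w t) • Pi.single j 1 by rw [← Pi.single_smul]; simp, map_smul,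
    Pi.smul_apply, smul_eq_mul, mul_comm]

lemma exp_sum_intCast_mul {F : Type*} [Field F] (ι : F →+* ℂ) {I : Type*} [Fintype I]
    (α : I → F) (ℓ : I → ℂ) (hexp : ∀ i, Complex.exp (ℓ i) = ι (α i)) (t : I → ℤ) :
    Complex.exp (∑ k, (t k : ℂ) * ℓ k) = ι (∏ k, α k ^ t k) := by
  rw [Complex.exp_sum, map_prod]
  exact Finset.prod_congr rfl fun k _ => by rw [Complex.exp_int_mul, hexp, map_zpow₀]

variable {F : Type} [Field F] [NumberField F]

lemma sum_galois_eq_sum_trace [IsGalois ℚ F] (ι : F →+* ℂ) {I : Type*} [Fintype I]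
    (ℓ : I → ℂ) (β : I → 𝓞 F) (ξ : 𝓞 F) :
    ∑ σ : Gal(F/ℚ), ι (σ ξ) * ∑ k, ι (σ (β k)) * ℓ k
      = ∑ k, (Algebra.trace ℤ (𝓞 F) (ξ * β k) : ℂ) * ℓ k := by
  simp_rw [Finset.mul_sum]
  rw [Finset.sum_comm]
  refine Finset.sum_congr rfl fun k _ => ?_
  have h := congrArg ι (trace_eq_sum_automorphisms (K := ℚ) ((ξ * β k : 𝓞 F) : F))
  rw [← Algebra.coe_trace_int, map_sum, eq_ratCast, Rat.cast_intCast, map_intCast] at h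
  rw [h, Finset.sum_mul]
  refine Finset.sum_congr rfl fun σ _ => ?_
  simp only [map_mul, mul_assoc]

/-- Finitely many elements of a number field have a common positive denominator. -/
lemma exists_common_denominator {K : Type*} (T : K → F) [Finite K] :
    ∃ b : ℕ, b ≠ 0 ∧ ∃ a : K → 𝓞 F, ∀ k, (a k : F) = b * T k := by
  classical
  cases nonempty_fintype K
  obtain ⟨y, hy, h⟩ := exists_integral_multiples ℤ ℚ (Finset.univ.image T)
  have hint : ∀ k, IsIntegral ℤ ((y.natAbs : F) * T k) := fun k => by
    have hk := h (T k) (Finset.mem_image_of_mem _ (Finset.mem_univ k))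
    rw [zsmul_eq_mul] at hk
    rcases Int.natAbs_eq y with e | e <;> rw [e] at hk
    · simpa using hk
    · simpa using hk.neg
  exact ⟨y.natAbs, Int.natAbs_ne_zero.2 hy, fun k => ⟨_, hint k⟩, fun k => rfl⟩

lemma forall_eq_zero_of_trace_mul_eq_zero {β : 𝓞 F}
    (h : ∀ ξ : 𝓞 F, Algebra.trace ℤ (𝓞 F) (ξ * β) = 0) : β = 0 := by
  by_contra hβ
  obtain ⟨x, hx⟩ : ∃ x : F, Algebra.trace ℚ F x ≠ 0 := by
    by_contra! hx
    exact Algebra.trace_ne_zero ℚ F (LinearMap.ext hx)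
  have hβF : (β : F) ≠ 0 := RingOfIntegers.coe_ne_zero_iff.2 hβ
  obtain ⟨b, hb, a, ha⟩ := exists_common_denominator (fun _ : Unit => x / β)
  have h1 := congrArg (Int.cast : ℤ → ℚ) (h (a ()))
  rw [Algebra.coe_trace_int, show ((a () * β : 𝓞 F) : F) = a () * β from map_mul _ _ _, ha,
    mul_assoc,
    div_mul_cancel₀ _ hβF, ← nsmul_eq_mul, map_nsmul, nsmul_eq_mul] at h1
  simp_all

/-- Baker's theorem over a Galois number field, with integral coefficients. -/
theorem eq_zero_of_linear_relation [IsGalois ℚ F] (ι : F →+* ℂ) {I : Type*} [Fintype I]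
    (α : I → F) (ℓ : I → ℂ) (hexp : ∀ i, Complex.exp (ℓ i) = ι (α i))
    (hind : LinearIndependent ℚ ℓ) (β₀ : 𝓞 F) (β : I → 𝓞 F)
    (hrel : ι β₀ + ∑ i, ι (β i) * ℓ i = 0) : β₀ = 0 ∧ ∀ i, β i = 0 := by
  classical
  have hβ_of : (∀ i, β i = 0) → β₀ = 0 ∧ ∀ i, β i = 0 := fun hβ => ⟨by simpa [hβ] using hrel, hβ⟩
  let w : Gal(F/ℚ) → ℂ := fun σ => ∑ k, ι (σ (β k)) * ℓ k
  by_cases hw0 : ∀ σ, w σ = 0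
  · refine hβ_of fun i => forall_eq_zero_of_trace_mul_eq_zero fun ξ => ?_
    have h := sum_galois_eq_sum_trace ι ℓ β ξ
    rw [Finset.sum_eq_zero fun σ _ => by rw [show ∑ k, ι (σ (β k)) * ℓ k = 0 from hw0 σ,
      mul_zero]] at h
    have := Fintype.linearIndependent_iff.1 hind
      (fun k => (Algebra.trace ℤ (𝓞 F) (ξ * β k) : ℚ)) (by simpa [Rat.smul_def] using h.symm) i
    exact_mod_cast this
  exfalso
  push Not at hw0
  let S := {σ // w σ ≠ 0}
  let J := Module.Free.ChooseBasisIndex ℤ (𝓞 F)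
  let η : Module.Basis J ℤ (𝓞 F) := RingOfIntegers.basis F
  let x : S → J → 𝓞 F := fun s j => RingOfIntegers.mapRingHom (s.1 : F →+* F) (η j)
  have hx : ∀ s j, ((x s j : 𝓞 F) : F) = s.1 (η j) := fun s j => rfl
  have hcardJ : Fintype.card J = Fintype.card Gal(F/ℚ) := by
    rw [← Nat.card_eq_fintype_card (α := Gal(F/ℚ)), IsGalois.card_aut_eq_finrank,
      ← RingOfIntegers.rank, Module.finrank_eq_card_basis η]
  have hsum : ∀ i j, ∑ s : S, ι (x s i) * (ι (x s j) * w s.1)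
      = ∑ k, (Algebra.trace ℤ (𝓞 F) (η i * η j * β k) : ℂ) * ℓ k := fun i j => by
    rw [← sum_galois_eq_sum_trace ι ℓ β,
      ← Finset.sum_filter_of_ne (p := fun σ => w σ ≠ 0) fun σ _ h => right_ne_zero_of_mul h,
      Finset.sum_subtype (p := fun σ => w σ ≠ 0) _ (by simp)]
    refine Finset.sum_congr rfl fun s _ => ?_
    rw [hx, hx]
    simp only [map_mul, mul_assoc]
  let E : J × J → F := fun p => ∏ k, α k ^ Algebra.trace ℤ (𝓞 F) (η p.1 * η p.2 * β k)
  obtain ⟨b, hb, a, ha⟩ := exists_common_denominator E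
  have hbexp : ∀ i j, b * Complex.exp (∑ s : S, ι (x s i) * (ι (x s j) * w s.1))
      = ι (a (i, j)) := fun i j => by
    rw [hsum, exp_sum_intCast_mul ι α ℓ hexp, ha, map_mul, map_natCast]
  have hinj : ∀ (s₀ : S) (k : J → ℤ), ∑ j, (k j : 𝓞 F) * x s₀ j = 0 → k = 0 := fun s₀ k hk => by
    have hk' : ((∑ j, k j • η j : 𝓞 F) : F) = 0 := by
      apply s₀.1.injective
      have := congrArg (algebraMap (𝓞 F) F) hk
      simpa [hx] using this
    exact funext (Fintype.linearIndependent_iff.1 η.linearIndependent k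
      (RingOfIntegers.coe_eq_zero_iff.1 hk'))
  obtain ⟨A, hA⟩ := exists_dual_of_injective η
    (fun s : S => (ι.comp (s.1 : F →+* F)).comp (algebraMap (𝓞 F) F)) (fun s t h => by
      refine Subtype.ext (AlgEquiv.ext fun y => ?_)
      obtain ⟨p, q, -, rfl⟩ := IsFractionRing.div_surjective (A := 𝓞 F) y
      have h' : ∀ r : 𝓞 F, s.1 (r : F) = t.1 (r : F) := fun r => ι.injective (RingHom.congr_fun h r)
      rw [map_div₀, map_div₀, h', h']) (fun s => w s.1) fun s => s.2
  have h1 : w 1 = -ι β₀ := by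
    have : w 1 = ∑ k, ι (β k) * ℓ k := rfl
    rw [this]; linear_combination hrel
  by_cases hβ₀ : β₀ = 0
  · obtain ⟨σ, hσ⟩ := hw0
    refine false_of_exp_mem_field ι x (fun s => w s.1) ⟨σ, hσ⟩ 0 (fun i j => a (i, j)) hb hbexp
      (hinj _) hA (Or.inl ?_)
    rw [hcardJ]
    exact Fintype.card_subtype_lt (x := 1) (by simp [h1, hβ₀])
  · refine false_of_exp_mem_field ι x (fun s => w s.1) ⟨1, ?_⟩ (fun j => -(β₀ * η j))
      (fun i j => a (i, j)) hb hbexp (hinj _) hA (Or.inr ⟨?_, fun j => ?_⟩)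
    · rw [h1, neg_ne_zero, map_ne_zero]
      exact RingOfIntegers.coe_ne_zero_iff.2 hβ₀
    · rw [hcardJ]
      exact Fintype.card_subtype_le _
    · refine Eq.trans ?_ (congrArg (ι (η j) * ·) h1).symm
      simp [mul_comm]

end Descent

/-- **Baker's theorem on linear forms in logarithms (1966–68).**
Let `α₁, …, αₙ` be nonzero algebraic numbers and `ℓ₁, …, ℓₙ` choices of their complex
logarithms. If `ℓ₁, …, ℓₙ` are linearly independent over `ℚ`, then `1, ℓ₁, …, ℓₙ` are
linearly independent over the field of all complex algebraic numbers: any vanishing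
linear combination `β₀ + β₁ ℓ₁ + ⋯ + βₙ ℓₙ = 0` with algebraic coefficients has all
coefficients zero. -/
theorem baker_linear_forms_in_logarithms (n : ℕ) (α : Fin n → ℂ) (hα0 : ∀ i, α i ≠ 0)
    (hαalg : ∀ i, IsAlgebraic ℚ (α i)) (ℓ : Fin n → ℂ) (hexp : ∀ i, Complex.exp (ℓ i) = α i)
    (hind : LinearIndependent ℚ ℓ) (β₀ : ℂ) (β : Fin n → ℂ) (hβ₀ : IsAlgebraic ℚ β₀)
    (hβ : ∀ i, IsAlgebraic ℚ (β i)) (hrel : β₀ + ∑ i, β i * ℓ i = 0) :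
    β₀ = 0 ∧ ∀ i, β i = 0 := by
  have : IsAlgClosure ℚ (algebraicClosure ℚ ℂ) := by
    convert! algebraicClosure.isAlgClosure ℚ ℂ
  have : IsGalois ℚ (algebraicClosure ℚ ℂ) := { }
  let T : Option (Fin n) ⊕ Fin n → algebraicClosure ℚ ℂ := Sum.elim
    (fun o => o.elim ⟨β₀, mem_algebraicClosure_iff.2 hβ₀⟩ fun i =>
      ⟨β i, mem_algebraicClosure_iff.2 (hβ i)⟩)
    fun i => ⟨α i, mem_algebraicClosure_iff.2 (hαalg i)⟩
  let F := FiniteGaloisIntermediateField.adjoin ℚ (Set.range T)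
  have hT : ∀ k, T k ∈ F.toIntermediateField := fun k =>
    FiniteGaloisIntermediateField.subset_adjoin ℚ _ ⟨k, rfl⟩
  let ι : F →+* ℂ := (algebraMap (algebraicClosure ℚ ℂ) ℂ).comp (algebraMap F _)
  have : FiniteDimensional ℚ F := by convert! F.finiteDimensional
  have : IsGalois ℚ F := by convert! F.isGalois
  have : NumberField F := { }
  obtain ⟨b, hb, a, ha⟩ := exists_common_denominator
    fun o : Option (Fin n) => (⟨T (Sum.inl o), hT _⟩ : F)
  have hιa : ∀ o, ι (a o) = b * (T (Sum.inl o) : ℂ) := fun o => by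
    rw [ha, map_mul, map_natCast]; rfl
  have hbC : (b : ℂ) ≠ 0 := Nat.cast_ne_zero.2 hb
  obtain ⟨h₀, h⟩ := eq_zero_of_linear_relation ι (fun i => (⟨T (Sum.inr i), hT _⟩ : F)) ℓ hexp hind
    (a none) (fun i => a (some i)) (by
      simp_rw [hιa, mul_assoc, ← Finset.mul_sum, ← mul_add]
      rw [mul_eq_zero]
      exact Or.inr hrel)
  have hzero : ∀ o, a o = 0 → (T (Sum.inl o) : ℂ) = 0 := fun o ho => by
    have := hιa o
    rw [ho, show ((0 : NumberField.RingOfIntegers F) : F) = 0 from map_zero _, map_zero] at this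
    exact (mul_eq_zero.1 this.symm).resolve_left hbC
  exact ⟨hzero none h₀, fun i => hzero (some i) (h i)⟩
end

section
/- Let n ≥ 1 and let α₁, …, αₙ be nonzero algebraic numbers of degrees at most d and (classical) heights at most A, where d ≥ 4 and A ≥ 4 are integers, and let log αᵢ denote the principal value of the logarithm of αᵢ. If log α₁, …, log αₙ are linearly dependent over the rationals ℚ, then there exist rational integers b₁, …, bₙ, not all zero, with b₁·log α₁ + ⋯ + bₙ·log αₙ = 0 and max{|b₁|, …, |bₙ|} < (4^(n²)·d^(2n)·log A)^((2n+1)²). -/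
/-- `p` is the classical minimal polynomial of the complex number `α`: the (unique)
polynomial with rational integer coefficients having no common factor, positive leading
coefficient, vanishing at `α`, and of the same degree as the minimal polynomial of `α`
over `ℚ`. (Such a `p` exists exactly when `α` is algebraic.) -/
def IsClassicalMinPoly (α : ℂ) (p : Polynomial ℤ) : Prop :=
  p.content = 1 ∧ 0 < p.leadingCoeff ∧ Polynomial.aeval α p = 0 ∧
    p.degree = (minpoly ℚ α).degree

open NumberField Module

theorem trace_pow_prime_eq {K : Type*} [Field K] [NumberField K] (x : 𝓞 K) (p : ℕ)
    [Fact p.Prime] :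
    ((Algebra.trace ℤ (𝓞 K) (x ^ p) : ℤ) : ZMod p) = (Algebra.trace ℤ (𝓞 K) x : ℤ) := by
  classical
  let b := RingOfIntegers.basis K
  have key : ∀ M : Matrix (Free.ChooseBasisIndex ℤ (𝓞 K)) (Free.ChooseBasisIndex ℤ (𝓞 K)) ℤ,
      ((M.trace : ℤ) : ZMod p) = (M.map (Int.castRingHom (ZMod p))).trace := by
    intro M
    simp [Matrix.trace]
  rw [Algebra.trace_eq_matrix_trace b, Algebra.trace_eq_matrix_trace b, key, key, map_pow,
    Matrix.map_pow, ZMod.trace_pow_card, ← key, ZMod.pow_card]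

theorem trace_eq_sum_embeddings_complex {K : Type*} [Field K] [NumberField K] (x : 𝓞 K) :
    ((Algebra.trace ℤ (𝓞 K) x : ℤ) : ℂ) = ∑ σ : K →ₐ[ℚ] ℂ, σ (x : K) := by
  have h := trace_eq_sum_embeddings (K := ℚ) (L := K) ℂ (x := (x : K))
  rw [← h, ← Algebra.coe_trace_int]
  simp

/-- If the power sums of two families of complex numbers agree up to twice their size, then the
nonzero values of the first family occur in the second. -/
theorem exists_eq_of_sum_pow_eq {ι : Type*} [Fintype ι] (u v : ι → ℂ)
    (h : ∀ k, 1 ≤ k → k ≤ 2 * Fintype.card ι → ∑ i, u i ^ k = ∑ i, v i ^ k)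
    (i₀ : ι) (h0 : u i₀ ≠ 0) : ∃ j, v j = u i₀ := by
  classical
  by_contra! hv
  let S : Finset ℂ := (Finset.univ.image u ∪ Finset.univ.image v).erase (u i₀)
  let f : Polynomial ℂ := Polynomial.X * ∏ z ∈ S, (Polynomial.X - Polynomial.C z)
  have hS : S.card + 1 ≤ 2 * Fintype.card ι := by
    have hmem : u i₀ ∈ Finset.univ.image u ∪ Finset.univ.image v := by simp
    have h1 := Finset.card_erase_add_one hmem
    have h2 := Finset.card_union_le (Finset.univ.image u) (Finset.univ.image v)
    have h3 : (Finset.univ.image u).card ≤ Fintype.card ι := Finset.card_image_le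
    have h4 : (Finset.univ.image v).card ≤ Fintype.card ι := Finset.card_image_le
    simp only [S]
    omega
  have hdeg : f.natDegree ≤ 2 * Fintype.card ι := by
    refine Polynomial.natDegree_mul_le.trans ?_
    rw [Polynomial.natDegree_X, Polynomial.natDegree_finsetProd_X_sub_C_eq_card]
    omega
  have hsum : ∑ i, f.eval (u i) = ∑ i, f.eval (v i) := by
    simp_rw [Polynomial.eval_eq_sum_range]
    rw [Finset.sum_comm, Finset.sum_comm (s := Finset.univ)]
    refine Finset.sum_congr rfl fun k hk => ?_
    rw [← Finset.mul_sum, ← Finset.mul_sum]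
    rcases Nat.eq_zero_or_pos k with rfl | hk0
    · simp
    · rw [h k hk0 (by rw [Finset.mem_range] at hk; omega)]
  have hz : ∀ z ∈ S, f.eval z = 0 := by
    intro z hz
    rw [Polynomial.eval_mul, Polynomial.eval_prod, Finset.prod_eq_zero hz (by simp), mul_zero]
  have hr : ∑ i, f.eval (v i) = 0 :=
    Finset.sum_eq_zero fun i _ => hz _ (by simp [S, hv i])
  have hl : ∑ i, f.eval (u i) =
      ((Finset.univ.filter fun i => u i = u i₀).card : ℂ) * f.eval (u i₀) := by
    rw [← nsmul_eq_mul, ← Finset.sum_const, Finset.sum_filter]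
    refine Finset.sum_congr rfl fun i _ => ?_
    split_ifs with hi
    · rw [hi]
    · exact hz _ (by simp [S, hi])
  rw [hsum, hr] at hl
  rcases mul_eq_zero.1 hl.symm with hc | hc
  · rw [Nat.cast_eq_zero, Finset.card_eq_zero] at hc
    have : i₀ ∈ Finset.univ.filter fun i => u i = u i₀ := by simp
    simp [hc] at this
  · rw [Polynomial.eval_mul, Polynomial.eval_prod, mul_eq_zero, Finset.prod_eq_zero_iff] at hc
    rcases hc with hc | ⟨z, hz, hc⟩
    · exact h0 (by simpa using hc)
    · rw [Polynomial.eval_sub, Polynomial.eval_X, Polynomial.eval_C, sub_eq_zero] at hc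
      exact (Finset.mem_erase.1 hz).1 hc.symm

/-- A quantitative form of Kronecker's theorem: a nonzero algebraic integer all of whose conjugates
have absolute value at most `2 ^ (1 / (16 D ^ 2))`, `D` being the degree of an ambient number
field, is a root of unity. -/
theorem pow_eq_one_of_norm_pow_le_two {K : Type*} [Field K] [NumberField K] (x : 𝓞 K)
    (hx0 : x ≠ 0) (hx : ∀ σ : K →ₐ[ℚ] ℂ, ‖σ (x : K)‖ ^ (16 * finrank ℚ K ^ 2) ≤ 2) :
    ∃ m : ℕ, 0 < m ∧ (x : K) ^ m = 1 := by
  set D := finrank ℚ K with hD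
  have hDpos : 0 < D := finrank_pos
  have hcard : Fintype.card (K →ₐ[ℚ] ℂ) = D := AlgHom.card ℚ K ℂ
  obtain ⟨p, hp, hp4, hp8⟩ := Nat.exists_prime_lt_and_le_two_mul (4 * D) (by omega)
  have : Fact p.Prime := ⟨hp⟩
  have hbound : ∀ (σ : K →ₐ[ℚ] ℂ) (k : ℕ), k ≤ 16 * D ^ 2 → ‖σ (x : K)‖ ^ k ≤ 2 := by
    intro σ k hk
    rcases le_total ‖σ (x : K)‖ 1 with h1 | h1
    · exact (pow_le_one₀ (norm_nonneg _) h1).trans one_le_two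
    · exact (pow_le_pow_right₀ h1 hk).trans (hx σ)
  have htr : ∀ k, k ≤ 16 * D ^ 2 → |((Algebra.trace ℤ (𝓞 K) (x ^ k) : ℤ) : ℝ)| ≤ 2 * D := by
    intro k hk
    have h1 := trace_eq_sum_embeddings_complex (x ^ k)
    have h2 : ‖((Algebra.trace ℤ (𝓞 K) (x ^ k) : ℤ) : ℂ)‖ ≤ ∑ σ : K →ₐ[ℚ] ℂ, (2 : ℝ) := by
      rw [h1]
      refine norm_sum_le_of_le _ fun σ _ => ?_
      simpa using hbound σ k hk
    rw [Complex.norm_intCast, Finset.sum_const, Finset.card_univ, hcard, nsmul_eq_mul] at h2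
    linarith
  have heq : ∀ k, k ≤ 2 * D →
      Algebra.trace ℤ (𝓞 K) (x ^ k) = Algebra.trace ℤ (𝓞 K) ((x ^ k) ^ p) := by
    intro k hk
    have hdvd : (p : ℤ) ∣ Algebra.trace ℤ (𝓞 K) (x ^ k) - Algebra.trace ℤ (𝓞 K) ((x ^ k) ^ p) :=
      (ZMod.intCast_eq_intCast_iff_dvd_sub _ _ p).1 (trace_pow_prime_eq (x ^ k) p)
    have h1 := htr k (by nlinarith)
    have h2 := htr (k * p) (by nlinarith [Nat.mul_le_mul hk hp8])
    rw [pow_mul] at h2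
    have h3 : |Algebra.trace ℤ (𝓞 K) (x ^ k) - Algebra.trace ℤ (𝓞 K) ((x ^ k) ^ p)| < (p : ℤ) := by
      have : |((Algebra.trace ℤ (𝓞 K) (x ^ k) : ℤ) : ℝ)
          - (Algebra.trace ℤ (𝓞 K) ((x ^ k) ^ p) : ℤ)| < p := by
        have h4 : ((4 * D : ℕ) : ℝ) < p := by exact_mod_cast hp4
        push_cast at h4
        exact (abs_sub _ _).trans_lt (by linarith)
      exact_mod_cast this
    exact sub_eq_zero.1 (Int.eq_zero_of_abs_lt_dvd hdvd h3)
  have hroot : ∀ σ : K →ₐ[ℚ] ℂ, ∃ τ : K →ₐ[ℚ] ℂ, τ (x : K) ^ p = σ (x : K) := by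
    intro σ
    refine exists_eq_of_sum_pow_eq (fun σ : K →ₐ[ℚ] ℂ => σ (x : K))
      (fun σ : K →ₐ[ℚ] ℂ => σ (x : K) ^ p) (fun k _ hk => ?_) σ (by simpa using hx0)
    rw [hcard] at hk
    have h1 := trace_eq_sum_embeddings_complex (x ^ k)
    have h2 := trace_eq_sum_embeddings_complex ((x ^ k) ^ p)
    rw [← heq k hk, h1] at h2
    simpa [← pow_mul, mul_comm] using h2
  have hle : ∀ σ : K →ₐ[ℚ] ℂ, ‖σ (x : K)‖ ≤ 1 := by
    by_contra! hex
    obtain ⟨σ, hσ, hmin⟩ := Finset.exists_min_image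
      (Finset.univ.filter fun σ : K →ₐ[ℚ] ℂ => 1 < ‖σ (x : K)‖) (fun σ => ‖σ (x : K)‖)
      (by obtain ⟨σ, hσ⟩ := hex; exact ⟨σ, by simpa using hσ⟩)
    obtain ⟨τ, hτ⟩ := hroot σ
    have hσ1 : 1 < ‖σ (x : K)‖ := by simpa using hσ
    rw [← hτ, norm_pow] at hσ1
    have hτ1 : 1 < ‖τ (x : K)‖ := by
      by_contra! h
      exact hσ1.not_ge (pow_le_one₀ (norm_nonneg _) h)
    have h1 := hmin τ (by simpa using hτ1)
    rw [← hτ, norm_pow] at h1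
    exact h1.not_gt (lt_self_pow₀ hτ1 hp.one_lt)
  obtain ⟨m, hm, h⟩ := Embeddings.pow_eq_one_of_norm_le_one K ℂ (x := (x : K))
    (by simpa using hx0) x.isIntegral_coe (fun φ => hle φ.toRatAlgHom)
  exact ⟨m, hm, h⟩

theorem le_totient_sq_mul_gcd_two (n : ℕ) : n ≤ n.totient ^ 2 * n.gcd 2 := by
  induction n using Nat.recOnPosPrimePosCoprime with
  | prime_pow p k hp hk =>
    rw [Nat.totient_prime_pow hp hk]
    obtain ⟨k, rfl⟩ := Nat.exists_eq_add_of_lt hk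
    simp only [zero_add, Nat.add_sub_cancel]
    have hpos : 0 < p ^ k := pow_pos hp.pos k
    rcases hp.two_le.eq_or_lt with rfl | h3
    · have : (2 ^ (k + 1)).gcd 2 = 2 := Nat.gcd_eq_right (dvd_pow_self 2 (by omega))
      rw [this, pow_succ]
      nlinarith
    · obtain ⟨q, rfl⟩ := Nat.exists_eq_add_of_le h3
      have hg : 1 ≤ ((2 + 1 + q) ^ (k + 1)).gcd 2 := Nat.gcd_pos_of_pos_right _ two_pos
      refine le_trans ?_ (Nat.le_mul_of_pos_right _ hg)
      have : 2 + 1 + q - 1 = q + 2 := by omega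
      rw [Nat.succ_eq_add_one] at *
      rw [this, pow_succ, mul_pow]
      refine Nat.mul_le_mul ?_ ?_
      · nlinarith
      · nlinarith
  | zero => simp
  | one => simp
  | coprime a b _ _ hab iha ihb =>
    rw [Nat.totient_mul hab, Nat.gcd_comm (a * b), hab.gcd_mul, Nat.gcd_comm 2, Nat.gcd_comm 2]
    calc a * b ≤ _ := Nat.mul_le_mul iha ihb
      _ = _ := by ring

theorem le_two_mul_totient_sq (n : ℕ) : n ≤ 2 * n.totient ^ 2 := by
  have h := le_totient_sq_mul_gcd_two n
  have h2 : n.gcd 2 ≤ 2 := Nat.gcd_le_right n two_pos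
  nlinarith [Nat.mul_le_mul_left (n.totient ^ 2) h2]

theorem orderOf_le_two_mul_finrank_sq {K : Type*} [Field K] [NumberField K] (x : K)
    (hx : IsOfFinOrder x) : orderOf x ≤ 2 * finrank ℚ K ^ 2 := by
  have hprim := IsPrimitiveRoot.orderOf x
  have h1 := hprim.totient_le_degree_minpoly
  have hint : IsIntegral ℤ x := hprim.isIntegral hx.orderOf_pos
  have h2 : (minpoly ℤ x).natDegree ≤ finrank ℚ K := by
    rw [← (minpoly.monic hint).natDegree_map (algebraMap ℤ ℚ),
      ← minpoly.isIntegrallyClosed_eq_field_fractions' ℚ hint]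
    exact minpoly.natDegree_le x
  refine (le_two_mul_totient_sq _).trans ?_
  gcongr
  exact h1.trans h2

theorem isIntegral_of_mul_pow {K : Type*} [Field K] [NumberField K] (x : K) (G : ℤ) (N : ℕ)
    (hG : G ≠ 0) (hGN : G.natAbs ^ finrank ℚ K < 2 ^ N) (h : IsIntegral ℤ ((G : K) * x ^ N)) :
    IsIntegral ℤ x := by
  suffices hx : ∀ v : IsDedekindDomain.HeightOneSpectrum (𝓞 K), v.valuation K x ≤ 1 by
    obtain ⟨y, rfl⟩ :=
      IsDedekindDomain.HeightOneSpectrum.mem_integers_of_valuation_le_one (R := 𝓞 K) K x hx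
    exact y.isIntegral_coe
  intro v
  by_contra! hv
  obtain ⟨y, hy⟩ : ∃ y : 𝓞 K, algebraMap (𝓞 K) K y = (G : K) * x ^ N := ⟨⟨_, h⟩, rfl⟩
  have hle : v.valuation K ((G : K) * x ^ N) ≤ 1 := hy ▸ v.valuation_le_one y
  have hexp : WithZero.exp (1 : ℤ) ≤ v.valuation K x := by
    have hne : v.valuation K x ≠ 0 := (zero_lt_one.trans hv).ne'
    rw [← WithZero.exp_log hne, WithZero.exp_le_exp]
    have := (WithZero.lt_log_iff_exp_lt hne (a := 0)).2 (by simpa using hv)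
    omega
  have hG' : v.intValuation (G : 𝓞 K) ≤ WithZero.exp (-(N : ℤ)) := by
    have h0 : algebraMap (𝓞 K) K (G : 𝓞 K) = (G : K) := by simp
    have h1 : v.intValuation (G : 𝓞 K) = v.valuation K (G : K) := by
      rw [← h0, v.valuation_of_algebraMap]
    rw [h1]
    rw [map_mul, map_pow] at hle
    have h1 : v.valuation K (G : K) * WithZero.exp (N : ℤ) ≤ 1 := by
      refine le_trans ?_ hle
      gcongr
      calc WithZero.exp (N : ℤ) = WithZero.exp (1 : ℤ) ^ N := by
            rw [← WithZero.exp_nsmul]; simp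
        _ ≤ _ := pow_le_pow_left₀ zero_le hexp N
    rw [WithZero.exp_neg, ← one_div]
    exact (le_div_iff₀ (by simp)).2 h1
  rw [v.intValuation_le_pow_iff_dvd] at hG'
  have h2 := map_dvd Ideal.absNorm hG'
  rw [map_pow, Ideal.absNorm_span_singleton] at h2
  have hn : (Algebra.norm ℤ (G : 𝓞 K)).natAbs = G.natAbs ^ finrank ℚ K := by
    have := Algebra.norm_algebraMap (R := ℤ) (S := 𝓞 K) G
    rw [← RingOfIntegers.rank K, ← Int.natAbs_pow, ← this]
    simp
  rw [hn] at h2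
  have h3 := Nat.le_of_dvd (pow_pos (Int.natAbs_pos.2 hG) _) h2
  have h4 : 2 ^ N ≤ Ideal.absNorm v.asIdeal ^ N := Nat.pow_le_pow_left (NumberField.HeightOneSpectrum.one_lt_absNorm v) N
  omega
theorem finrank_adjoin_range_le {n : ℕ} (α : Fin n → ℂ) (d : ℕ)
    (hα : ∀ i, (minpoly ℚ (α i)).natDegree ≤ d) (hint : ∀ i, IsIntegral ℚ (α i)) :
    finrank ℚ (IntermediateField.adjoin ℚ (Set.range α)) ≤ d ^ n := by
  induction n with
  | zero => rw [Set.range_eq_empty, IntermediateField.adjoin_empty, IntermediateField.finrank_bot, pow_zero]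
  | succ n ih =>
    have h : Set.range α = Set.range (fun i : Fin n => α i.succ) ∪ {α 0} := by
      rw [← Fin.cons_self_tail α, Fin.range_cons, Set.insert_eq, Set.union_comm]
      rfl
    rw [h, IntermediateField.adjoin_union, pow_succ]
    refine (IntermediateField.finrank_sup_le _ _).trans ?_
    refine Nat.mul_le_mul (ih _ (fun i => hα _) fun i => hint _) ?_
    rw [IntermediateField.adjoin.finrank (hint 0)]
    exact hα 0

theorem norm_le_of_aeval_eq_zero {p : Polynomial ℤ} (hp : p ≠ 0) {A : ℕ}
    (hA : ∀ j, |p.coeff j| ≤ (A : ℤ)) {z : ℂ} (hz : Polynomial.aeval z p = 0) :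
    ‖z‖ ≤ A + 1 := by
  have hmap : p.map (Int.castRingHom ℂ) ≠ 0 :=
    (Polynomial.map_ne_zero_iff (RingHom.injective_int _)).2 hp
  have hroot : (p.map (Int.castRingHom ℂ)).IsRoot z := by
    rw [Polynomial.IsRoot, Polynomial.eval_map]
    exact hz
  have h := (hroot.norm_lt_cauchyBound hmap).le
  have h2 : Polynomial.cauchyBound (p.map (Int.castRingHom ℂ)) ≤ (A : NNReal) + 1 := by
    unfold Polynomial.cauchyBound
    gcongr
    have hl : 1 ≤ ‖(p.map (Int.castRingHom ℂ)).leadingCoeff‖₊ := by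
      rw [Polynomial.leadingCoeff_map_of_injective (RingHom.injective_int _)]
      have : (1 : ℝ) ≤ |((p.leadingCoeff : ℤ) : ℝ)| := by
        exact_mod_cast Int.one_le_abs (Polynomial.leadingCoeff_ne_zero.2 hp)
      rw [← NNReal.coe_le_coe]
      simpa [Int.norm_eq_abs] using this
    refine (div_le_self zero_le hl).trans (Finset.sup_le fun j _ => ?_)
    rw [← NNReal.coe_le_coe]
    have : |((p.coeff j : ℤ) : ℝ)| ≤ A := by exact_mod_cast hA j
    simpa [Int.norm_eq_abs] using this
  have h3 : ‖z‖₊ ≤ (A : NNReal) + 1 := h.trans h2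
  exact_mod_cast h3

theorem abs_coeff_reverse_le {p : Polynomial ℤ} {A : ℕ} (hA : ∀ j, |p.coeff j| ≤ (A : ℤ)) (j : ℕ) :
    |p.reverse.coeff j| ≤ (A : ℤ) := by
  rw [Polynomial.coeff_reverse]
  exact hA _

theorem aeval_reverse_inv {K : Type*} [Field K] {p : Polynomial ℤ} {z : K} (hz : z ≠ 0)
    (h : Polynomial.aeval z p = 0) : Polynomial.aeval z⁻¹ p.reverse = 0 := by
  let := invertibleOfNonzero hz
  rw [← invOf_eq_inv, Polynomial.aeval_def, Polynomial.eval₂_reverse_eq_zero_iff,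
    ← Polynomial.aeval_def, h]

/-- A denominator bound for a root of an integer polynomial and for its inverse. -/
theorem exists_isIntegral_mul_zpow {K : Type*} [Field K] {p : Polynomial ℤ} (hp : p ≠ 0) {A : ℕ}
    (hA : ∀ j, |p.coeff j| ≤ (A : ℤ)) {z : K} (hz : z ≠ 0) (h : Polynomial.aeval z p = 0) :
    ∃ g : ℤ, g ≠ 0 ∧ g.natAbs ≤ A ^ 2 ∧
      ∀ (e : ℤ) (m : ℕ), e.natAbs ≤ m → IsIntegral ℤ ((g : K) ^ m * z ^ e) := by
  have hrev : p.reverse ≠ 0 := by simpa using hp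
  have h1 := isIntegral_leadingCoeff_smul p z h
  have h2 := isIntegral_leadingCoeff_smul _ _ (aeval_reverse_inv hz h)
  set a := p.leadingCoeff with ha
  set b := p.reverse.leadingCoeff with hb
  rw [zsmul_eq_mul] at h1 h2
  have hint : ∀ k : ℤ, IsIntegral ℤ (k : K) := fun k => isIntegral_algebraMap (x := k)
  refine ⟨a * b, mul_ne_zero (Polynomial.leadingCoeff_ne_zero.2 hp)
    (Polynomial.leadingCoeff_ne_zero.2 hrev), ?_, fun e m hm => ?_⟩
  · have h3 : |a| ≤ (A : ℤ) := hA _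
    have h4 : |b| ≤ (A : ℤ) := abs_coeff_reverse_le hA _
    rw [Int.natAbs_mul, sq]
    rw [Int.abs_eq_natAbs] at h3 h4
    exact Nat.mul_le_mul (by omega) (by omega)
  · obtain ⟨k, rfl⟩ := Nat.exists_eq_add_of_le hm
    rw [pow_add, mul_right_comm]
    refine IsIntegral.mul ?_ ((hint _).pow k)
    push_cast
    rcases Int.natAbs_eq e with he | he
    · rw [he, Int.natAbs_natCast, zpow_natCast, ← mul_pow, mul_right_comm]
      exact (h1.mul (hint b)).pow _
    · rw [he, Int.natAbs_neg, Int.natAbs_natCast, zpow_neg, zpow_natCast, ← inv_pow, ← mul_pow,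
        mul_assoc]
      exact ((hint a).mul h2).pow _

/-- Simultaneous Dirichlet approximation for the rationals `b i / B`, with integer data. -/
theorem exists_simultaneous_approx {n N : ℕ} (hN : 0 < N) (b : Fin n → ℤ) {B : ℤ} (hB : 0 < B) :
    ∃ (q : ℕ) (c : Fin n → ℤ), 0 < q ∧ q ≤ N ^ n ∧
      ∀ i, (N : ℤ) * |B * c i - q * b i| < B := by
  let f : ℕ → Fin n → ℕ := fun q i => ((N : ℤ) * (q * b i % B) / B).toNat
  have hf0 : ∀ (q : ℕ) i, 0 ≤ (N : ℤ) * (q * b i % B) / B := fun q i =>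
    Int.ediv_nonneg (mul_nonneg (by positivity) (Int.emod_nonneg _ hB.ne')) hB.le
  have hmaps : ∀ q ∈ Finset.range (N ^ n + 1), f q ∈ Fintype.piFinset fun _ => Finset.range N := by
    intro q _
    rw [Fintype.mem_piFinset]
    intro i
    rw [Finset.mem_range]
    have : (N : ℤ) * (q * b i % B) / B < N := by
      refine Int.ediv_lt_of_lt_mul hB ?_
      have := Int.emod_lt_of_pos (q * b i) hB
      gcongr
    have := hf0 q i
    simp only [f]
    omega
  obtain ⟨x, hx, y, hy, hxy, hfxy⟩ := Finset.exists_ne_map_eq_of_card_lt_of_maps_to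
    (by simp [Fintype.card_piFinset]) hmaps
  wlog hlt : y < x generalizing x y
  · exact this y hy x hx hxy.symm hfxy.symm (by omega)
  rw [Finset.mem_range] at hx
  refine ⟨x - y, fun i => x * b i / B - y * b i / B, by omega, by omega, fun i => ?_⟩
  have h1 : (N : ℤ) * (x * b i % B) / B = (N : ℤ) * (y * b i % B) / B := by
    have h := congrFun hfxy i
    have := hf0 x i
    have := hf0 y i
    simp only [f] at h
    omega
  have h2 := Int.emod_add_mul_ediv (x * b i) B
  have h3 := Int.emod_add_mul_ediv (y * b i) B
  have h4 : B * (x * b i / B - y * b i / B) - ((x - y : ℕ) : ℤ) * b i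
      = y * b i % B - x * b i % B := by
    push_cast [hlt.le]
    linarith
  rw [h4, ← Nat.abs_cast N, ← abs_mul]
  have h5 := Int.emod_add_mul_ediv ((N : ℤ) * (x * b i % B)) B
  have h6 := Int.emod_add_mul_ediv ((N : ℤ) * (y * b i % B)) B
  have h7 := Int.emod_nonneg ((N : ℤ) * (x * b i % B)) hB.ne'
  have h8 := Int.emod_nonneg ((N : ℤ) * (y * b i % B)) hB.ne'
  have h9 := Int.emod_lt_of_pos ((N : ℤ) * (x * b i % B)) hB
  have h10 := Int.emod_lt_of_pos ((N : ℤ) * (y * b i % B)) hB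
  rw [h1] at h5
  rw [abs_lt]
  constructor <;> linarith

theorem norm_zpow_le_pow_natAbs {z : ℂ} {M : ℝ} (hM : 1 ≤ M) (h1 : ‖z‖ ≤ M) (h2 : ‖z⁻¹‖ ≤ M)
    {e : ℤ} {m : ℕ} (hm : e.natAbs ≤ m) : ‖z ^ e‖ ≤ M ^ m := by
  refine le_trans ?_ (pow_le_pow_right₀ hM hm)
  rcases Int.natAbs_eq e with he | he
  · rw [he, Int.natAbs_natCast, zpow_natCast, norm_pow]
    gcongr
  · rw [he, Int.natAbs_neg, Int.natAbs_natCast, zpow_neg, zpow_natCast, ← inv_pow, norm_pow]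
    gcongr

/-- If the exponents `c` are nearly proportional to the exponents `b` of a multiplicative relation,
then the corresponding power product is a root of unity. -/
theorem isOfFinOrder_prod_zpow {K : Type*} [Field K] [NumberField K] {n D A L : ℕ} (hn : 1 ≤ n)
    (hD : finrank ℚ K ≤ D) (hAL : A + 1 ≤ 2 ^ L) (hL : 1 ≤ L) (a : Fin n → K) (ha : ∀ i, a i ≠ 0)
    (p : Fin n → Polynomial ℤ) (hp : ∀ i, p i ≠ 0) (hpA : ∀ i j, |(p i).coeff j| ≤ (A : ℤ))
    (hpa : ∀ i, Polynomial.aeval (a i) (p i) = 0) (b c : Fin n → ℤ) (hb : ∏ i, a i ^ b i = 1)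
    {B q : ℕ} (hB : 0 < B)
    (hc : ∀ i, ((16 * n * D ^ 2 * L : ℕ) : ℤ) * |(B : ℤ) * c i - q * b i| < B) :
    IsOfFinOrder (∏ i, a i ^ c i) := by
  set N := 16 * n * D ^ 2 * L with hN
  set β := ∏ i, a i ^ c i with hβ
  have hDpos : 0 < finrank ℚ K := finrank_pos
  have hβ0 : β ≠ 0 := Finset.prod_ne_zero_iff.2 fun i _ => zpow_ne_zero _ (ha i)
  have hβB : (β ^ N) ^ B = ∏ i, a i ^ ((N : ℤ) * (B * c i - q * b i)) := by
    have h1 : (∏ i, a i ^ b i) ^ (-(N * q : ℤ)) = 1 := by rw [hb, one_zpow]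
    rw [← mul_one ((β ^ N) ^ B), ← h1, ← Finset.prod_zpow, hβ, ← pow_mul, ← Finset.prod_pow,
      ← Finset.prod_mul_distrib]
    refine Finset.prod_congr rfl fun i _ => ?_
    rw [← zpow_natCast, ← zpow_mul, ← zpow_mul, ← zpow_add₀ (ha i)]
    congr 1
    push_cast
    ring
  have hexp : ∀ i, ((N : ℤ) * (B * c i - q * b i)).natAbs ≤ B := by
    intro i
    have := hc i
    rw [← Nat.abs_cast N, ← abs_mul, Int.abs_eq_natAbs] at this
    omega
  have hintegral : IsIntegral ℤ β := by
    choose g hg0 hgA hg using fun i => exists_isIntegral_mul_zpow (hp i) (hpA i) (ha i) (hpa i)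
    refine isIntegral_of_mul_pow β (∏ i, g i) N (Finset.prod_ne_zero_iff.2 fun i _ => hg0 i) ?_ ?_
    · have h1 : (∏ i, g i).natAbs ≤ (A ^ 2) ^ n := by
        rw [← Int.natAbsHom_apply, map_prod]
        refine (Finset.prod_le_pow_card _ _ (A ^ 2) fun i _ => ?_).trans (by simp)
        exact hgA i
      calc (∏ i, g i).natAbs ^ finrank ℚ K ≤ (((2 ^ L) ^ 2) ^ n) ^ D := by
            refine (Nat.pow_le_pow_left h1 _).trans ?_
            refine le_trans ?_ (Nat.pow_le_pow_right (by positivity) hD)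
            gcongr
            omega
        _ = 2 ^ (2 * (n * D * L)) := by rw [← pow_mul, ← pow_mul, ← pow_mul]; ring_nf
        _ < 2 ^ N := by
            refine Nat.pow_lt_pow_right one_lt_two ?_
            have h2 : 1 ≤ D := hDpos.trans_le hD
            have h3 : 0 < n * D * L := by positivity
            have h4 : N = 16 * D * (n * D * L) := by rw [hN]; ring
            rw [h4]
            nlinarith
    · refine IsIntegral.of_pow hB ?_
      rw [mul_pow, hβB]
      push_cast
      rw [← Finset.prod_pow, ← Finset.prod_mul_distrib]
      exact IsIntegral.prod _ fun i _ => hg i _ _ (hexp i)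
  have hnorm : ∀ σ : K →ₐ[ℚ] ℂ, ‖σ β‖ ^ (16 * finrank ℚ K ^ 2) ≤ 2 := by
    intro σ
    rcases le_total ‖σ β‖ 1 with h1 | h1
    · exact (pow_le_one₀ (norm_nonneg _) h1).trans one_le_two
    have hM : (1 : ℝ) ≤ 2 ^ L := one_le_pow₀ one_le_two
    have hAM : (A : ℝ) + 1 ≤ 2 ^ L := by exact_mod_cast hAL
    have hroot : ∀ i, Polynomial.aeval (σ (a i)) (p i) = 0 := fun i => by
      have h := Polynomial.aeval_algHom_apply (σ.restrictScalars ℤ) (a i) (p i)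
      rw [hpa i, map_zero] at h
      exact h
    have h2 : (‖σ β‖ ^ N) ^ B ≤ ((2 ^ L) ^ n) ^ B := by
      rw [← norm_pow, ← norm_pow, ← map_pow, ← map_pow, hβB, map_prod, norm_prod]
      calc _ ≤ ∏ _i : Fin n, ((2 : ℝ) ^ L) ^ B := by
            refine Finset.prod_le_prod (fun _ _ => norm_nonneg _) fun i _ => ?_
            rw [map_zpow₀]
            refine norm_zpow_le_pow_natAbs hM ?_ ?_ (hexp i)
            · exact (norm_le_of_aeval_eq_zero (hp i) (hpA i) (hroot i)).trans hAM
            · refine (norm_le_of_aeval_eq_zero (p := (p i).reverse) (by simpa using hp i)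
                (abs_coeff_reverse_le (hpA i)) (aeval_reverse_inv ?_ (hroot i))).trans hAM
              simpa using ha i
        _ = _ := by
            rw [Finset.prod_const, Finset.card_univ, Fintype.card_fin, ← pow_mul, ← pow_mul,
              ← pow_mul, ← pow_mul]
            ring_nf
    have h3 : ‖σ β‖ ^ N ≤ (2 ^ L) ^ n := (pow_le_pow_iff_left₀ (by positivity) (by positivity)
      hB.ne').1 h2
    have h4 : (‖σ β‖ ^ (16 * D ^ 2)) ^ (L * n) ≤ 2 ^ (L * n) := by
      rw [← pow_mul, pow_mul 2]
      convert h3 using 2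
      rw [hN]; ring
    have h5 := (pow_le_pow_iff_left₀ (by positivity) (by positivity)
      (by positivity : L * n ≠ 0)).1 h4
    refine le_trans (pow_le_pow_right₀ h1 ?_) h5
    gcongr
  obtain ⟨m, hm, h⟩ := pow_eq_one_of_norm_pow_le_two (⟨β, hintegral⟩ : 𝓞 K)
    (fun h => hβ0 (congrArg (algebraMap (𝓞 K) K) h)) hnorm
  exact isOfFinOrder_iff_pow_eq_one.2 ⟨m, hm, h⟩

theorem norm_log_le {z : ℂ} {L : ℕ} (h1 : ‖z‖ ≤ 2 ^ L) (h2 : ‖z⁻¹‖ ≤ 2 ^ L) (hz : z ≠ 0) :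
    ‖Complex.log z‖ ≤ L + Real.pi := by
  have hpos : 0 < ‖z‖ := norm_pos_iff.2 hz
  have hlog2 : Real.log 2 ≤ 1 := by linarith [Real.log_two_lt_d9]
  have hlogM : Real.log (2 ^ L) ≤ L := by
    rw [Real.log_pow]
    exact mul_le_of_le_one_right (Nat.cast_nonneg _) hlog2
  have h3 := Real.log_le_log hpos h1
  have h4 := Real.log_le_log (norm_pos_iff.2 (inv_ne_zero hz)) h2
  rw [norm_inv, Real.log_inv] at h4
  refine (Complex.norm_le_abs_re_add_abs_im _).trans (add_le_add ?_ ?_)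
  · rw [Complex.log_re, abs_le]
    constructor <;> linarith
  · rw [Complex.log_im]
    exact Complex.abs_arg_le_pi z

theorem baker_numeric_bound {n d A L : ℕ} (hn : 1 ≤ n) (hd : 4 ≤ d) (hA : 4 ≤ A)
    (hL : 2 ^ L ≤ 2 * A) :
    ((16 * n * (d ^ n) ^ 2 * L : ℕ) : ℝ) ^ n + 1 <
      ((4 : ℝ) ^ (n ^ 2) * (d : ℝ) ^ (2 * n) * Real.log A) ^ ((2 * n + 1) ^ 2) := by
  set X := (4 : ℝ) ^ (n ^ 2) * (d : ℝ) ^ (2 * n) * Real.log A with hX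
  have hlog4 : (1.38 : ℝ) ≤ Real.log A := by
    have h1 : Real.log 4 ≤ Real.log A := Real.log_le_log (by norm_num) (by exact_mod_cast hA)
    have h2 : Real.log 4 = 2 * Real.log 2 := by
      rw [show (4 : ℝ) = 2 ^ 2 by norm_num, Real.log_pow]; norm_num
    linarith [Real.log_two_gt_d9]
  have hLlog : (L : ℝ) ≤ 4 * Real.log A := by
    have hA0 : (0 : ℝ) < A := by positivity
    have h1 : Real.log (2 ^ L) ≤ Real.log (2 * A) :=
      Real.log_le_log (by positivity) (by exact_mod_cast hL)
    rw [Real.log_pow, Real.log_mul two_ne_zero hA0.ne'] at h1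
    have h2 : (L : ℝ) * 0.69 ≤ L * Real.log 2 := by
      gcongr
      linarith [Real.log_two_gt_d9]
    linarith [Real.log_two_lt_d9]
  have hn4 : (n : ℝ) ≤ 4 ^ (n ^ 2) := by
    have h1 : n < 4 ^ n := Nat.lt_pow_self (by norm_num)
    have h2 : 4 ^ n ≤ 4 ^ (n ^ 2) := Nat.pow_le_pow_right (by norm_num) (by nlinarith)
    exact_mod_cast h1.le.trans h2
  have hd16 : (16 : ℝ) ≤ (d : ℝ) ^ (2 * n) := by
    have hd' : (4 : ℝ) ≤ d := by exact_mod_cast hd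
    calc (16 : ℝ) = 4 ^ 2 := by norm_num
      _ ≤ (d : ℝ) ^ 2 := by gcongr
      _ ≤ _ := pow_le_pow_right₀ (by linarith) (by omega)
  have h4 : (4 : ℝ) ≤ 4 ^ (n ^ 2) := le_self_pow₀ (by norm_num) (by positivity)
  have hX64 : 64 ≤ X := by
    calc (64 : ℝ) ≤ 4 * 16 * 1.38 := by norm_num
      _ ≤ X := by rw [hX]; gcongr
  have hNX : ((16 * n * (d ^ n) ^ 2 * L : ℕ) : ℝ) ≤ X ^ 2 := by
    push_cast
    calc (16 : ℝ) * n * (d ^ n) ^ 2 * L ≤ 16 * 4 ^ (n ^ 2) * (d ^ n) ^ 2 * (4 * Real.log A) := by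
          gcongr
      _ = 64 * X := by rw [hX]; ring
      _ ≤ X ^ 2 := by nlinarith
  have h1 : (1 : ℝ) ≤ X ^ (2 * n) := one_le_pow₀ (by linarith)
  calc ((16 * n * (d ^ n) ^ 2 * L : ℕ) : ℝ) ^ n + 1 ≤ (X ^ 2) ^ n + 1 := by gcongr
    _ = X ^ (2 * n) + 1 := by rw [← pow_mul]
    _ < X ^ (2 * n) * X := by nlinarith
    _ = X ^ (2 * n + 1) := (pow_succ _ _).symm
    _ ≤ X ^ ((2 * n + 1) ^ 2) := pow_le_pow_right₀ (by linarith) (by nlinarith)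

/-- An integer relation, normalised so that its largest coefficient in absolute value is
positive. -/
theorem exists_relation_of_not_linearIndependent {n : ℕ} (v : Fin n → ℂ)
    (h : ¬ LinearIndependent ℚ v) :
    ∃ (b : Fin n → ℤ) (i₀ : Fin n), ∑ i, (b i : ℂ) * v i = 0 ∧ 0 < b i₀ ∧
      ∀ i, |b i| ≤ b i₀ := by
  rw [← LinearIndependent.iff_fractionRing (R := ℤ), Fintype.not_linearIndependent_iff] at h
  obtain ⟨b, hb, j, hj⟩ := h
  simp_rw [zsmul_eq_mul] at hb
  obtain ⟨i₀, -, hi₀⟩ := Finset.exists_max_image Finset.univ (fun i => |b i|) ⟨j, Finset.mem_univ j⟩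
  have hpos : 0 < |b i₀| := (abs_pos.2 hj).trans_le (hi₀ j (Finset.mem_univ j))
  rcases abs_choice (b i₀) with h0 | h0
  · exact ⟨b, i₀, hb, h0 ▸ hpos, fun i => h0 ▸ hi₀ i (Finset.mem_univ i)⟩
  · refine ⟨fun i => -b i, i₀, by simpa using hb, hpos.trans_eq h0, fun i => ?_⟩
    rw [abs_neg]
    exact (hi₀ i (Finset.mem_univ i)).trans_eq h0

/-- **Bounded relations between logarithms (implicit in Baker's Linear Forms IV, 1968).**
Let `α₁, …, αₙ` (`n ≥ 1`) be nonzero algebraic numbers with degrees at most `d` and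
classical heights at most `A`, where `d ≥ 4` and `A ≥ 4` are integers, and let `log αᵢ`
denote principal values. If `log α₁, …, log αₙ` are linearly dependent over `ℚ`, then
there are rational integers `b₁, …, bₙ`, not all zero, with
`b₁ log α₁ + ⋯ + bₙ log αₙ = 0` and `max |bᵢ| < (4^(n²) d^(2n) log A)^((2n+1)²)`. -/
theorem baker_bounded_relation (n d A : ℕ) (hn : 1 ≤ n) (hd : 4 ≤ d) (hA : 4 ≤ A)
    (α : Fin n → ℂ) (hα0 : ∀ i, α i ≠ 0)
    (hα : ∀ i, ∃ p : Polynomial ℤ, IsClassicalMinPoly (α i) p ∧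
      p.natDegree ≤ d ∧ ∀ j, |p.coeff j| ≤ (A : ℤ))
    (hdep : ¬ LinearIndependent ℚ fun i => Complex.log (α i)) :
    ∃ b : Fin n → ℤ, b ≠ 0 ∧ ∑ i, (b i : ℂ) * Complex.log (α i) = 0 ∧
      ∀ i, |(b i : ℝ)| < ((4 : ℝ) ^ (n ^ 2) * (d : ℝ) ^ (2 * n) * Real.log A)
        ^ ((2 * n + 1) ^ 2) := by
  choose p hpmin hpd hpA using hα
  have hp0 : ∀ i, p i ≠ 0 := fun i h => by simpa [h] using (hpmin i).2.1
  have hpα : ∀ i, Polynomial.aeval (α i) (p i) = 0 := fun i => (hpmin i).2.2.1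
  have hint : ∀ i, IsIntegral ℚ (α i) := fun i =>
    ((IsFractionRing.isAlgebraic_iff ℤ ℚ ℂ).1 ⟨p i, hp0 i, hpα i⟩).isIntegral
  have hdeg : ∀ i, (minpoly ℚ (α i)).natDegree ≤ d := fun i => by
    rw [← Polynomial.natDegree_eq_of_degree_eq (hpmin i).2.2.2]
    exact hpd i
  set K := IntermediateField.adjoin ℚ (Set.range α) with hK
  have hfin : FiniteDimensional ℚ K := IntermediateField.finiteDimensional_adjoin <| by
    rintro _ ⟨i, rfl⟩
    exact hint i
  have : NumberField K := { to_charZero := inferInstance, to_finiteDimensional := hfin }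
  have hrank : finrank ℚ K ≤ d ^ n := finrank_adjoin_range_le α d hdeg hint
  let a : Fin n → K := fun i => ⟨α i, IntermediateField.subset_adjoin _ _ ⟨i, rfl⟩⟩
  have ha0 : ∀ i, a i ≠ 0 := fun i h => hα0 i (congrArg Subtype.val h)
  have haα : ∀ e : Fin n → ℤ, ((∏ i, a i ^ e i : K) : ℂ) =
      Complex.exp (∑ i, (e i : ℂ) * Complex.log (α i)) := by
    intro e
    rw [Complex.exp_sum]
    simp_rw [Complex.exp_int_mul, Complex.exp_log (hα0 _)]
    push_cast
    rfl
  obtain ⟨b, i₀, hb, hbpos, hbmax⟩ := exists_relation_of_not_linearIndependent _ hdep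
  obtain ⟨B, hB⟩ := Int.eq_ofNat_of_zero_le hbpos.le
  have hBpos : 0 < B := by omega
  set L := Nat.log 2 A + 1 with hLdef
  have hAL : A + 1 ≤ 2 ^ L := Nat.lt_pow_succ_log_self one_lt_two A
  have hL2 : 2 ^ L ≤ 2 * A := by
    rw [pow_succ, mul_comm]
    exact Nat.mul_le_mul_left 2 (Nat.pow_log_le_self 2 (by omega))
  have hL : 1 ≤ L := by omega
  set N := 16 * n * (d ^ n) ^ 2 * L with hN
  have hNpos : 0 < N := by positivity
  obtain ⟨q, c, hq, hqN, hc⟩ := exists_simultaneous_approx hNpos b (B := (B : ℤ)) (by omega)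
  have hcB : ∀ i, |(B : ℤ) * c i - q * b i| < B := fun i =>
    (le_mul_of_one_le_left (abs_nonneg _) (by exact_mod_cast hNpos)).trans_lt (hc i)
  have hfinord : IsOfFinOrder (∏ i, a i ^ c i) := by
    refine isOfFinOrder_prod_zpow hn hrank hAL hL a ha0 p hp0 hpA (fun i => ?_) b c ?_ hBpos hc
    · apply Subtype.val_injective
      have h := Polynomial.aeval_algHom_apply (K.val.restrictScalars ℤ) (a i) (p i)
      exact h.symm.trans (hpα i)
    · apply Subtype.val_injective
      rw [haα, hb, Complex.exp_zero]
      rfl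
  have hw := orderOf_le_two_mul_finrank_sq _ hfinord
  have hwpos := hfinord.orderOf_pos
  set w := orderOf (∏ i, a i ^ c i)
  set Λ := ∑ i, (c i : ℂ) * Complex.log (α i) with hΛ
  have hexpΛ : Complex.exp (w * Λ) = 1 := by
    rw [Complex.exp_nat_mul, ← haα, ← SubmonoidClass.coe_pow, pow_orderOf_eq_one]
    rfl
  have hM : (A : ℝ) + 1 ≤ 2 ^ L := by exact_mod_cast hAL
  have hlogα : ∀ i, ‖Complex.log (α i)‖ ≤ L + Real.pi := fun i => by
    refine norm_log_le ((norm_le_of_aeval_eq_zero (hp0 i) (hpA i) (hpα i)).trans hM)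
      ((norm_le_of_aeval_eq_zero (p := (p i).reverse) (by simpa using hp0 i)
        (abs_coeff_reverse_le (hpA i)) (aeval_reverse_inv (hα0 i) (hpα i))).trans hM) (hα0 i)
  have hBΛ : (N : ℂ) * (B * Λ) =
      ∑ i, (((N : ℤ) * (B * c i - q * b i) : ℤ) : ℂ) * Complex.log (α i) := by
    have h1 : (B : ℂ) * Λ = B * Λ - q * ∑ i, (b i : ℂ) * Complex.log (α i) := by
      rw [hb, mul_zero, sub_zero]
    rw [h1, hΛ, Finset.mul_sum, Finset.mul_sum, ← Finset.sum_sub_distrib, Finset.mul_sum]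
    refine Finset.sum_congr rfl fun i _ => ?_
    push_cast
    ring
  have hNΛ : N * ‖Λ‖ ≤ n * (L + Real.pi) := by
    have h1 : ‖(N : ℂ) * (B * Λ)‖ ≤ ∑ _i : Fin n, (B : ℝ) * (L + Real.pi) := by
      rw [hBΛ]
      refine norm_sum_le_of_le _ fun i _ => ?_
      rw [norm_mul, Complex.norm_intCast]
      gcongr
      · have h2 := (hc i).le
        rw [← Nat.abs_cast N, ← abs_mul] at h2
        exact_mod_cast h2
      · exact hlogα i
    rw [Finset.sum_const, Finset.card_univ, Fintype.card_fin, nsmul_eq_mul, norm_mul, norm_mul,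
      Complex.norm_natCast, Complex.norm_natCast] at h1
    have hB0 : (0 : ℝ) < B := by exact_mod_cast hBpos
    refine le_of_mul_le_mul_left ?_ hB0
    linarith
  have hΛ0 : Λ = 0 := by
    obtain ⟨k, hk⟩ := Complex.exp_eq_one_iff.1 hexpΛ
    have hw0 : (w : ℂ) ≠ 0 := by exact_mod_cast hwpos.ne'
    rcases eq_or_ne k 0 with rfl | hk0
    · simpa [hw0] using hk
    exfalso
    have h1 : 2 * Real.pi ≤ w * ‖Λ‖ := by
      have h2 := congrArg norm hk
      have h3 : ‖(2 * Real.pi * Complex.I : ℂ)‖ = 2 * Real.pi := by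
        simp [abs_of_pos Real.pi_pos]
      rw [norm_mul, norm_mul (k : ℂ), Complex.norm_natCast, h3, Complex.norm_intCast] at h2
      rw [h2]
      have h4 : (1 : ℝ) ≤ |(k : ℝ)| := by exact_mod_cast Int.one_le_abs hk0
      exact le_mul_of_one_le_left (by positivity) h4
    have hwD : (w : ℝ) ≤ 2 * (d ^ n) ^ 2 := by
      have : w ≤ 2 * (d ^ n) ^ 2 := hw.trans (by gcongr)
      exact_mod_cast this
    have h5 : N * (2 * Real.pi) ≤ 2 * (d ^ n) ^ 2 * (n * (L + Real.pi)) := by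
      calc N * (2 * Real.pi) ≤ N * (w * ‖Λ‖) := by gcongr
        _ = w * (N * ‖Λ‖) := by ring
        _ ≤ _ := by gcongr
    have h6 : (0 : ℝ) < 2 * (d ^ n) ^ 2 * n := by positivity
    rw [hN] at h5
    push_cast at h5
    have h7 : 16 * L * Real.pi ≤ L + Real.pi := by
      refine le_of_mul_le_mul_left ?_ h6
      linarith
    have h8 : (1 : ℝ) ≤ L := by exact_mod_cast hL
    nlinarith [Real.pi_gt_three]
  refine ⟨c, fun h => ?_, hΛ0, fun i => ?_⟩
  · have h1 := hcB i₀
    rw [h, hB, Pi.zero_apply, mul_zero, zero_sub, abs_neg, abs_of_nonneg (by positivity)] at h1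
    have : (1 : ℤ) ≤ q := by exact_mod_cast hq
    have : (0 : ℤ) < B := by omega
    nlinarith
  · have hcq : |c i| ≤ q + 1 := by
      have hB0 : (0 : ℤ) < B := by omega
      have h1 : |(B : ℤ) * c i| ≤ |(B : ℤ) * c i - q * b i| + |q * b i| := by
        simpa using abs_add_le ((B : ℤ) * c i - q * b i) (q * b i)
      rw [abs_mul, abs_mul, Nat.abs_cast, Nat.abs_cast] at h1
      have h2 : (q : ℤ) * |b i| ≤ q * B := by
        gcongr
        exact hB ▸ hbmax i
      refine le_of_mul_le_mul_left ?_ hB0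
      linarith [hcB i]
    have h2 : |c i| ≤ ((N ^ n + 1 : ℕ) : ℤ) := by
      push_cast
      have : (q : ℤ) ≤ (N : ℤ) ^ n := by exact_mod_cast hqN
      omega
    have h3 : |(c i : ℝ)| ≤ (N : ℝ) ^ n + 1 := by exact_mod_cast h2
    exact h3.trans_lt (baker_numeric_bound hn hd hA hL2)
end
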